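/- arXiv:1812.11701 — 3 statements merged into one kernel-verified Lean document; each statement's English description precedes it below -/
import Mathlib

section
/- Let ψ̃ be a smooth function on ℝ compactly supported in a set not containing the origin (say supported in [−2, −1/2] ∪ [1/2, 2]) and let φ̃ be a smooth compactly supported function on ℝ. Define ρ(ξ₁, η) = μ₂(ξ₁, η) ψ̃(ξ₁) φ̃(η), where μ₂(ξ₁, η) = ∫₀¹ sgn(α ξ₁ + η) dα. Then for every N ∈ ℕ there is a constant C_N such that for all u, v ∈ ℝ the inverse Fourier transform ρ̌ of ρ satisfies |ρ̌(u, v)| ≤ C_N (1 + |v|)^{−2} ((1 + |v − u|)^{−N} + (1 + |u|)^{−N}). -/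
open MeasureTheory

/-- `μ₂(ξ₁,η) = ∫₀¹ sgn(αξ₁ + η) dα`. -/
noncomputable def mu2 (ξ η : ℝ) : ℝ :=
  ∫ α in Set.Icc (0:ℝ) 1, Real.sign (α * ξ + η)

/-- The inverse Fourier transform `ρ̌(u,v) = ∫_{ℝ²} e^{2πi(ξ₁u + ηv)} ρ(ξ₁,η) d(ξ₁,η)`
of a function `ρ` on `ℝ²`. -/
noncomputable def invFourier2 (ρ : ℝ × ℝ → ℝ) (u v : ℝ) : ℂ :=
  ∫ p : ℝ × ℝ,
    Complex.exp (((2 * Real.pi * (p.1 * u + p.2 * v) : ℝ) : ℂ) * Complex.I) * (ρ p : ℂ)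

open MeasureTheory FourierTransform SchwartzMap

namespace Mu2Aux

noncomputable def E (x : ℝ) : ℂ := Complex.exp (((2 * Real.pi * x : ℝ) : ℂ) * Complex.I)

lemma E_add (x y : ℝ) : E (x + y) = E x * E y := by
  unfold E; rw [← Complex.exp_add]; congr 1; push_cast; ring

lemma norm_E (x : ℝ) : ‖E x‖ = 1 := by
  unfold E; exact Complex.norm_exp_ofReal_mul_I _

@[fun_prop]
lemma continuous_E : Continuous E := by unfold E; fun_prop

lemma integral_sign (a b : ℝ) : ∫ x in a..b, Real.sign x = |b| - |a| := by
  apply integral_eq_of_hasDerivAt_off_countable (fun x => |x|) _ (Set.countable_singleton (0:ℝ))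
  · fun_prop
  · intro x hx
    have hx0 : x ≠ 0 := hx.2
    rcases lt_or_gt_of_ne hx0 with h | h
    · rw [Real.sign_of_neg h]; exact hasDerivAt_abs_neg h
    · rw [Real.sign_of_pos h]; exact hasDerivAt_abs_pos h
  · apply Monotone.intervalIntegrable
    intro x y hxy
    unfold Real.sign
    split_ifs <;> linarith

lemma mu2_eq (ξ η : ℝ) (h : ξ ≠ 0) : mu2 ξ η = (|ξ + η| - |η|) / ξ := by
  unfold mu2
  rw [integral_Icc_eq_integral_Ioc, ← intervalIntegral.integral_of_le zero_le_one]
  have := intervalIntegral.integral_comp_mul_add (a := 0) (b := 1) Real.sign h η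
  simp_rw [mul_comm _ ξ]
  rw [this, integral_sign]
  simp [div_eq_inv_mul]

lemma schwartz_decay (f : 𝓢(ℝ, ℂ)) (N : ℕ) :
    ∃ C : ℝ, 0 < C ∧ ∀ x, ‖f x‖ ≤ C * ((1 + |x|) ^ N)⁻¹ := by
  set M := 2 ^ N * (Finset.Iic (N, 0)).sup (fun m => SchwartzMap.seminorm ℝ (F := ℂ) (E := ℝ) m.1 m.2) f with hM
  have key : ∀ x, (1 + |x|) ^ N * ‖f x‖ ≤ M := fun x => by
    have := SchwartzMap.one_add_le_sup_seminorm_apply (𝕜 := ℝ) (m := (N, 0)) (k := N) (n := 0)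
      le_rfl le_rfl f x
    rw [norm_iteratedFDeriv_zero, Real.norm_eq_abs] at this
    exact this
  have hM0 : 0 ≤ M := le_trans (by positivity) (key 0)
  refine ⟨M + 1, by positivity, fun x => ?_⟩
  rw [← div_eq_mul_inv, le_div_iff₀ (by positivity), mul_comm]
  linarith [key x]

lemma invFourier_eq (f : 𝓢(ℝ, ℂ)) (w : ℝ) : 𝓕⁻ f w = ∫ s, f s * E (s * w) := by
  rw [SchwartzMap.fourierInv_coe, Real.fourierInv_eq']
  congr 1; ext s
  simp only [E, smul_eq_mul]
  rw [mul_comm]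
  simp [mul_comm]

lemma fourier_inversion (f : 𝓢(ℝ, ℂ)) (x : ℝ) : f x = ∫ t, (𝓕 f) t * E (t * x) := by
  rw [← invFourier_eq, FourierTransform.fourierInv_fourier_eq]

lemma inv_decay (f : 𝓢(ℝ, ℂ)) (N : ℕ) :
    ∃ C : ℝ, 0 < C ∧ ∀ w, ‖∫ s, f s * E (s * w)‖ ≤ C * ((1 + |w|) ^ N)⁻¹ := by
  obtain ⟨C, hC, h⟩ := schwartz_decay (𝓕⁻ f) N
  exact ⟨C, hC, fun w => by rw [← invFourier_eq]; exact h w⟩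

lemma hasDerivAt_E (v s : ℝ) :
    HasDerivAt (fun s : ℝ => E (s * v)) ((2 * Real.pi * v * Complex.I) * E (s * v)) s := by
  unfold E
  have h1 : HasDerivAt (fun s : ℝ => (((2 * Real.pi * (s * v) : ℝ) : ℂ) * Complex.I))
      (2 * Real.pi * v * Complex.I) s := by
    have h2 : HasDerivAt (fun s : ℝ => (2 * Real.pi * (s * v) : ℝ)) (2 * Real.pi * v) s := by
      simpa using ((hasDerivAt_id s).mul_const v).const_mul (2 * Real.pi)
    simpa using h2.ofReal_comp.mul_const Complex.I
  simpa [mul_comm] using h1.cexp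

lemma half_decay (h : ℝ → ℂ) (hh : ContDiff ℝ (⊤ : ℕ∞) h) (R : ℝ) (h0 : h 0 = 0) (hR : h R = 0)
    (hR' : deriv h R = 0) :
    ∃ C : ℝ, 0 < C ∧ ∀ v : ℝ, ‖∫ s in (0:ℝ)..R, h s * E (s * v)‖ ≤ C * ((1 + |v|) ^ 2)⁻¹ := by
  have hd1 : ContDiff ℝ (⊤ : ℕ∞) (deriv h) := (contDiff_infty_iff_deriv.1 hh).2
  have hd2 : ContDiff ℝ (⊤ : ℕ∞) (deriv (deriv h)) := (contDiff_infty_iff_deriv.1 hd1).2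
  have hc0 := hh.continuous
  have hc2 := hd2.continuous
  obtain ⟨A, hA⟩ := (isCompact_uIcc (a := (0:ℝ)) (b := R)).exists_bound_of_continuousOn
    hc0.continuousOn
  obtain ⟨B, hB⟩ := (isCompact_uIcc (a := (0:ℝ)) (b := R)).exists_bound_of_continuousOn
    hc2.continuousOn
  have hA0 : 0 ≤ A := (norm_nonneg _).trans (hA 0 Set.left_mem_uIcc)
  have hB0 : 0 ≤ B := (norm_nonneg _).trans (hB 0 Set.left_mem_uIcc)
  set D := A * |R - 0| + (‖deriv h 0‖ + B * |R - 0|) with hD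
  have hD0 : 0 ≤ D := by positivity
  refine ⟨4 * D + 1, by positivity, fun v => ?_⟩
  have b1 : ‖∫ s in (0:ℝ)..R, h s * E (s * v)‖ ≤ A * |R - 0| := by
    apply intervalIntegral.norm_integral_le_of_norm_le_const
    intro x hx
    rw [norm_mul, norm_E, mul_one]
    exact hA x (Set.uIoc_subset_uIcc hx)
  have b2 : ‖∫ s in (0:ℝ)..R, deriv (deriv h) s * E (s * v)‖ ≤ B * |R - 0| := by
    apply intervalIntegral.norm_integral_le_of_norm_le_const
    intro x hx
    rw [norm_mul, norm_E, mul_one]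
    exact hB x (Set.uIoc_subset_uIcc hx)
  rw [← div_eq_mul_inv, le_div_iff₀ (by positivity)]
  have key : |v| ^ 2 * ‖∫ s in (0:ℝ)..R, h s * E (s * v)‖ ≤ ‖deriv h 0‖ + B * |R - 0| := by
    set c : ℂ := 2 * Real.pi * v * Complex.I with hc
    have ftc : ∫ s in (0:ℝ)..R, (c ^ 2 * (h s * E (s * v)) - deriv (deriv h) s * E (s * v))
        = (c * h R - deriv h R) * E (R * v) - (c * h 0 - deriv h 0) * E (0 * v) := by
      apply intervalIntegral.integral_eq_sub_of_hasDerivAt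
        (f := fun s => (c * h s - deriv h s) * E (s * v))
      · intro x _
        have e1 := ((hh.differentiable (by simp) x).hasDerivAt.const_mul c).sub
          (hd1.differentiable (by simp) x).hasDerivAt
        refine HasDerivAt.congr_deriv (e1.mul (hasDerivAt_E v x)) ?_
        simp only [Pi.sub_apply]
        rw [← hc]; ring
      · apply Continuous.intervalIntegrable
        fun_prop
    rw [intervalIntegral.integral_sub (Continuous.intervalIntegrable (by fun_prop) _ _)
      (Continuous.intervalIntegrable (by fun_prop) _ _), intervalIntegral.integral_const_mul,
      h0, hR, hR'] at ftc
    have e2 : c ^ 2 * ∫ s in (0:ℝ)..R, h s * E (s * v) =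
        deriv h 0 * E (0 * v) + ∫ s in (0:ℝ)..R, deriv (deriv h) s * E (s * v) := by
      linear_combination ftc
    have e3 := congrArg norm e2
    rw [norm_mul, norm_pow] at e3
    have e4 : |v| ≤ ‖c‖ := by
      rw [hc]; simp only [norm_mul, Complex.norm_I, Complex.norm_real, Real.norm_eq_abs,
        abs_of_pos Real.pi_pos, Complex.norm_ofNat]
      nlinarith [Real.pi_gt_three, abs_nonneg v]
    calc _ ≤ ‖c‖ ^ 2 * ‖∫ s in (0:ℝ)..R, h s * E (s * v)‖ := by gcongr
      _ ≤ ‖deriv h 0 * E (0 * v)‖ + B * |R - 0| := by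
          rw [e3]; exact (norm_add_le _ _).trans (by gcongr)
      _ = _ := by rw [norm_mul, norm_E, mul_one]
  have : (1 + |v|) ^ 2 ≤ 2 + 2 * |v| ^ 2 := by nlinarith [sq_nonneg (1 - |v|)]
  have hn := norm_nonneg (∫ s in (0:ℝ)..R, h s * E (s * v))
  nlinarith [mul_le_mul_of_nonneg_left this hn]

lemma abs_decay (g : ℝ → ℂ) (hg : ContDiff ℝ (⊤ : ℕ∞) g) (hs : HasCompactSupport g) :
    ∃ C : ℝ, 0 < C ∧ ∀ v : ℝ, ‖∫ s : ℝ, |s| * g s * E (s * v)‖ ≤ C * ((1 + |v|) ^ 2)⁻¹ := by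
  obtain ⟨R, hR0, hR⟩ := hs.isCompact.isBounded.subset_ball_lt 0 (0:ℝ)
  have hz : ∀ x, R ≤ |x| → x ∉ tsupport g := fun x hx hm => by
    have := hR hm
    simp at this
    linarith
  have hcd : ContDiff ℝ (⊤ : ℕ∞) (fun s : ℝ => (s : ℂ) * g s) :=
    (Complex.ofRealCLM.contDiff).mul hg
  have hcdn : ContDiff ℝ (⊤ : ℕ∞) (fun s : ℝ => -((s : ℂ) * g s)) := hcd.neg
  have dz : ∀ x, R ≤ |x| → deriv (fun s : ℝ => (s : ℂ) * g s) x = 0 := fun x hx => by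
    have : (fun s : ℝ => (s : ℂ) * g s) =ᶠ[nhds x] fun _ => 0 := by
      filter_upwards [notMem_tsupport_iff_eventuallyEq.1 (hz x hx)] with y hy
      simp [hy]
    rw [this.deriv_eq]; simp
  have gz : ∀ x, R ≤ |x| → g x = 0 := fun x hx => image_eq_zero_of_notMem_tsupport (hz x hx)
  obtain ⟨C1, hC1, h1⟩ := half_decay _ hcd R (by simp) (by simp [gz R (le_abs_self R)])
    (dz R (le_abs_self R))
  obtain ⟨C2, hC2, h2⟩ := half_decay _ hcdn (-R) (by simp)
    (by simp [gz (-R) (by simp [le_abs_self])])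
    (by
      have := dz (-R) (by simp [le_abs_self])
      rw [deriv.fun_neg, this, neg_zero])
  refine ⟨C1 + C2, by positivity, fun v => ?_⟩
  have hgc := hg.continuous
  have split : ∫ s : ℝ, |s| * g s * E (s * v) =
      (∫ s in (0:ℝ)..R, s * g s * E (s * v)) - ∫ s in (0:ℝ)..(-R), -(s * g s) * E (s * v) := by
    have e1 : ∫ s : ℝ, |s| * g s * E (s * v) = ∫ s in (-R)..R, |s| * g s * E (s * v) := by
      rw [intervalIntegral.integral_eq_integral_of_support_subset]
      intro x hx
      by_contra hcon
      apply hx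
      have : R ≤ |x| := by
        by_contra h'
        push Not at h'
        exact hcon ⟨(abs_lt.1 h').1, (abs_lt.1 h').2.le⟩
      simp [gz x this]
    have hci : Continuous fun s : ℝ => ((|s| : ℝ) : ℂ) * g s * E (s * v) := by fun_prop
    rw [e1, ← intervalIntegral.integral_add_adjacent_intervals (b := 0)
      (hci.intervalIntegrable _ _) (hci.intervalIntegrable _ _),
      intervalIntegral.integral_symm 0 (-R), add_comm, sub_eq_add_neg]
    congr 1
    · apply intervalIntegral.integral_congr
      intro x hx
      rw [Set.uIcc_of_le hR0.le] at hx
      simp [abs_of_nonneg hx.1]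
    · congr 1
      apply intervalIntegral.integral_congr
      intro x hx
      rw [Set.uIcc_of_ge (by linarith)] at hx
      simp [abs_of_nonpos hx.2]
  rw [split]
  refine (norm_sub_le _ _).trans ?_
  rw [add_mul]
  exact add_le_add (h1 v) (h2 v)

lemma integrable_E (f g : ℝ → ℂ) (hf : Integrable f) (hg : Integrable g) (k : ℝ × ℝ → ℝ)
    (hk : Continuous k) : Integrable (fun p : ℝ × ℝ => f p.1 * g p.2 * E (k p))
      ((volume : Measure ℝ).prod volume) := by
  refine (hf.mul_prod hg).mul_bdd (c := 1) ?_ ?_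
  · exact (continuous_E.comp hk).aestronglyMeasurable
  · exact Filter.Eventually.of_forall fun p => (norm_E _).le

lemma A_eq (χ F : 𝓢(ℝ, ℂ)) (G : ℝ → ℂ) (hG : Integrable G)
    (hθ : ∀ ξ s : ℝ, χ ξ * (|s| * F (s - ξ)) = χ ξ * (G s * F (s - ξ))) (u v : ℝ) :
    ∫ ξ, χ ξ * E (ξ * u) * ∫ η : ℝ, |ξ + η| * F η * E (η * v) =
      ∫ t, (𝓕 F) t * (∫ ξ, χ ξ * E (ξ * (u - v - t))) * (∫ s, G s * E (s * (v + t))) := by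
  have hF : Integrable (𝓕 F : 𝓢(ℝ, ℂ)) := SchwartzMap.integrable _
  have step1 : ∀ ξ, χ ξ * E (ξ * u) * ∫ η : ℝ, |ξ + η| * F η * E (η * v) =
      χ ξ * E (ξ * (u - v)) * ∫ s : ℝ, G s * F (s - ξ) * E (s * v) := fun ξ => by
    rw [← integral_sub_right_eq_self _ ξ, ← integral_const_mul, ← integral_const_mul]
    congr 1; ext s
    have e1 : E ((s - ξ) * v) = E (s * v) * E (-ξ * v) := by rw [← E_add]; ring_nf
    have e2 : E (ξ * (u - v)) = E (ξ * u) * E (-ξ * v) := by rw [← E_add]; ring_nf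
    rw [e1, e2, add_sub_cancel]
    linear_combination (E (ξ * u) * E (s * v) * E (-ξ * v)) * hθ ξ s
  have step2 : ∀ ξ, ∫ s : ℝ, G s * F (s - ξ) * E (s * v) =
      ∫ t, (𝓕 F) t * E (-t * ξ) * ∫ s, G s * E (s * (v + t)) := fun ξ => by
    have : ∀ s, G s * F (s - ξ) * E (s * v) =
        ∫ t, G s * (𝓕 F) t * E (s * v + t * (s - ξ)) := fun s => by
      rw [fourier_inversion F (s - ξ), ← integral_const_mul, ← integral_mul_const]
      congr 1; ext t
      rw [E_add]; ring
    simp_rw [this]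
    rw [integral_integral_swap
      (integrable_E G (𝓕 F : 𝓢(ℝ, ℂ)) hG hF (fun p => p.1 * v + p.2 * (p.1 - ξ)) (by fun_prop))]
    congr 1; ext t
    rw [← integral_const_mul]
    congr 1; ext s
    have : E (s * v + t * (s - ξ)) = E (-t * ξ) * E (s * (v + t)) := by rw [← E_add]; ring_nf
    rw [this]; ring
  simp_rw [step1, step2]
  have hFH : Integrable (fun t => (𝓕 F) t * ∫ s, G s * E (s * (v + t))) := by
    have := (integrable_E G (𝓕 F : 𝓢(ℝ, ℂ)) hG hF
      (fun p => p.1 * (v + p.2)) (by fun_prop)).integral_prod_right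
    refine this.congr (Filter.Eventually.of_forall fun t => ?_)
    simp only
    rw [← integral_const_mul]
    congr 1; ext s; ring
  have step3 : ∀ ξ, χ ξ * E (ξ * (u - v)) *
      ∫ t, (𝓕 F) t * E (-t * ξ) * ∫ s, G s * E (s * (v + t)) =
      ∫ t, χ ξ * ((𝓕 F) t * ∫ s, G s * E (s * (v + t))) * E (ξ * (u - v - t)) := fun ξ => by
    rw [← integral_const_mul]
    congr 1; ext t
    have : E (ξ * (u - v - t)) = E (ξ * (u - v)) * E (-t * ξ) := by rw [← E_add]; ring_nf
    rw [this]; ring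
  simp_rw [step3]
  rw [integral_integral_swap
    (integrable_E χ _ χ.integrable hFH (fun p => p.1 * (u - v - p.2)) (by fun_prop))]
  congr 1; ext t
  rw [mul_right_comm]
  generalize (𝓕 F) t * ∫ s, G s * E (s * (v + t)) = c
  rw [← integral_const_mul]
  congr 1; ext ξ; ring

lemma peetre (a t : ℝ) (N : ℕ) :
    ((1 + |a + t|) ^ N)⁻¹ ≤ (1 + |t|) ^ N * ((1 + |a|) ^ N)⁻¹ := by
  rw [← div_eq_mul_inv, le_div_iff₀ (by positivity), inv_mul_le_iff₀ (by positivity), ← mul_pow]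
  gcongr
  have : |a| ≤ |a + t| + |t| := by
    have := abs_sub (a + t) t
    simpa using this
  nlinarith [mul_nonneg (abs_nonneg (a + t)) (abs_nonneg t)]

lemma A_bound (χ F : 𝓢(ℝ, ℂ)) (G : ℝ → ℂ) (hG : Integrable G)
    (hθ : ∀ ξ s : ℝ, χ ξ * (|s| * F (s - ξ)) = χ ξ * (G s * F (s - ξ)))
    (hGd : ∃ C : ℝ, 0 < C ∧ ∀ v : ℝ, ‖∫ s : ℝ, G s * E (s * v)‖ ≤ C * ((1 + |v|) ^ 2)⁻¹)
    (N : ℕ) : ∃ C : ℝ, 0 < C ∧ ∀ u v : ℝ,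
      ‖∫ ξ, χ ξ * E (ξ * u) * ∫ η : ℝ, |ξ + η| * F η * E (η * v)‖ ≤
        C * ((1 + |v|) ^ 2)⁻¹ * ((1 + |v - u|) ^ N)⁻¹ := by
  obtain ⟨C1, hC1, h1⟩ := schwartz_decay (𝓕 F) (N + 4)
  obtain ⟨C2, hC2, h2⟩ := inv_decay χ N
  obtain ⟨C3, hC3, h3⟩ := hGd
  have hI : 0 ≤ ∫ t : ℝ, (1 + t ^ 2)⁻¹ := integral_nonneg fun t => by positivity
  refine ⟨C1 * C2 * C3 * (∫ t : ℝ, (1 + t ^ 2)⁻¹) + 1, by positivity, fun u v => ?_⟩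
  rw [A_eq χ F G hG hθ]
  have hb : ∀ t : ℝ, ‖(𝓕 F) t * (∫ ξ, χ ξ * E (ξ * (u - v - t))) *
      (∫ s, G s * E (s * (v + t)))‖ ≤
      (C1 * C2 * C3 * ((1 + |v|) ^ 2)⁻¹ * ((1 + |v - u|) ^ N)⁻¹) * (1 + t ^ 2)⁻¹ := fun t => by
    rw [norm_mul, norm_mul]
    have k2 : ‖∫ ξ, χ ξ * E (ξ * (u - v - t))‖ ≤
        C2 * ((1 + |t|) ^ N * ((1 + |v - u|) ^ N)⁻¹) := by
      refine (h2 _).trans ?_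
      have := peetre (u - v) (-t) N
      rw [abs_neg, abs_sub_comm u v, ← sub_eq_add_neg] at this
      gcongr
    have k3 : ‖∫ s, G s * E (s * (v + t))‖ ≤ C3 * ((1 + |t|) ^ 2 * ((1 + |v|) ^ 2)⁻¹) := by
      refine (h3 _).trans ?_
      have := peetre v t 2
      gcongr
    have k4 : ((1 + |t|) ^ 2)⁻¹ ≤ (1 + t ^ 2)⁻¹ := by
      gcongr
      nlinarith [abs_nonneg t, sq_abs t]
    calc _ ≤ (C1 * ((1 + |t|) ^ (N + 4))⁻¹) * (C2 * ((1 + |t|) ^ N * ((1 + |v - u|) ^ N)⁻¹)) *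
          (C3 * ((1 + |t|) ^ 2 * ((1 + |v|) ^ 2)⁻¹)) := by
            gcongr
            exact h1 t
      _ = (C1 * C2 * C3 * ((1 + |v|) ^ 2)⁻¹ * ((1 + |v - u|) ^ N)⁻¹) * ((1 + |t|) ^ 2)⁻¹ := by
            have : (1 + |t|) ≠ 0 := by positivity
            have : ((1 + |t|) ^ (N + 4))⁻¹ * (1 + |t|) ^ N * (1 + |t|) ^ 2 = ((1 + |t|) ^ 2)⁻¹ := by
              rw [show N + 4 = N + 2 + 2 from rfl, pow_add, pow_add]
              field_simp
            rw [← this]; ring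
      _ ≤ _ := by gcongr
  refine (norm_integral_le_of_norm_le (integrable_inv_one_add_sq.const_mul _)
    (Filter.Eventually.of_forall hb)).trans ?_
  rw [integral_const_mul]
  have : 0 ≤ ((1 + |v|) ^ 2)⁻¹ * ((1 + |v - u|) ^ N)⁻¹ := by positivity
  nlinarith

lemma contDiff_div (ψ : ℝ → ℝ) (hψ : ContDiff ℝ (⊤ : ℕ∞) ψ) (h0 : (0:ℝ) ∉ tsupport ψ) :
    ContDiff ℝ (⊤ : ℕ∞) (fun x => ψ x / x) := by
  rw [contDiff_iff_contDiffAt]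
  intro x
  by_cases hx : x = 0
  · subst hx
    have : (fun x => ψ x / x) =ᶠ[nhds 0] fun _ => 0 := by
      filter_upwards [notMem_tsupport_iff_eventuallyEq.1 h0] with y hy
      simp [hy]
    exact contDiffAt_const.congr_of_eventuallyEq this
  · exact hψ.contDiffAt.div contDiffAt_id hx

lemma split_eq (χ φ : ℝ → ℂ) (hχ : Continuous χ) (hφ : Continuous φ) (hχs : HasCompactSupport χ)
    (hφs : HasCompactSupport φ) (u v : ℝ) :
    ∫ p : ℝ × ℝ, E (p.1 * u + p.2 * v) * (((|p.1 + p.2| - |p.2| : ℝ) : ℂ) * χ p.1 * φ p.2) =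
    (∫ ξ, χ ξ * E (ξ * u) * ∫ η : ℝ, |ξ + η| * φ η * E (η * v)) -
      (∫ ξ, χ ξ * E (ξ * u)) * ∫ η : ℝ, |η| * φ η * E (η * v) := by
  have hint : ∀ k : ℝ × ℝ → ℝ, Continuous k → Integrable (fun p : ℝ × ℝ =>
      (χ p.1 * E (p.1 * u)) * (k p * φ p.2 * E (p.2 * v)))
      ((volume : Measure ℝ).prod volume) := fun k hk => by
    rw [← Measure.volume_eq_prod]
    apply Continuous.integrable_of_hasCompactSupport (by fun_prop)
    apply HasCompactSupport.intro (hχs.isCompact.prod hφs.isCompact)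
    intro p hp
    by_cases h1 : p.1 ∈ tsupport χ
    · have h2 : p.2 ∉ tsupport φ := fun h2 => hp ⟨h1, h2⟩
      simp [image_eq_zero_of_notMem_tsupport h2]
    · simp [image_eq_zero_of_notMem_tsupport h1]
  have e1 := integral_prod _ (hint (fun p => |p.1 + p.2|) (by fun_prop))
  have e2 := integral_prod _ (hint (fun p => |p.2|) (by fun_prop))
  simp only [integral_const_mul] at e1 e2
  rw [integral_mul_const] at e2
  rw [← e1, ← e2, ← integral_sub (hint (fun p => |p.1 + p.2|) (by fun_prop))
    (hint (fun p => |p.2|) (by fun_prop)), ← Measure.volume_eq_prod]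
  congr 1; ext p
  rw [E_add]; push_cast; ring

lemma main_aux (χ φ : ℝ → ℂ) (hχ : ContDiff ℝ (⊤ : ℕ∞) χ) (hφ : ContDiff ℝ (⊤ : ℕ∞) φ)
    (hχs : HasCompactSupport χ) (hφs : HasCompactSupport φ) (N : ℕ) :
    ∃ C : ℝ, 0 < C ∧ ∀ u v : ℝ,
      ‖∫ p : ℝ × ℝ, E (p.1 * u + p.2 * v) * (((|p.1 + p.2| - |p.2| : ℝ) : ℂ) * χ p.1 * φ p.2)‖ ≤
      C * ((1 + |v|) ^ 2)⁻¹ * (((1 + |v - u|) ^ N)⁻¹ + ((1 + |u|) ^ N)⁻¹) := by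
  obtain ⟨R1, hR10, hR1⟩ := hχs.isCompact.isBounded.subset_ball_lt 0 (0:ℝ)
  obtain ⟨R2, hR20, hR2⟩ := hφs.isCompact.isBounded.subset_ball_lt 0 (0:ℝ)
  let b : ContDiffBump (0:ℝ) := ⟨R1 + R2, R1 + R2 + 1, by positivity, by linarith⟩
  have hb : ContDiff ℝ (⊤ : ℕ∞) (fun s => (b s : ℂ)) := Complex.ofRealCLM.contDiff.comp b.contDiff
  have hbs : HasCompactSupport (fun s => (b s : ℂ)) :=
    b.hasCompactSupport.comp_left (g := fun x : ℝ => (x : ℂ)) (by simp)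
  let X : 𝓢(ℝ, ℂ) := hχs.toSchwartzMap hχ
  let F : 𝓢(ℝ, ℂ) := hφs.toSchwartzMap hφ
  have hX : ∀ x, X x = χ x := fun x => rfl
  have hF : ∀ x, F x = φ x := fun x => rfl
  have hbc := hb.continuous
  obtain ⟨C1, hC1, h1⟩ := A_bound X F (fun s => |s| * b s)
    (Continuous.integrable_of_hasCompactSupport (by fun_prop) hbs.mul_left)
    (by
      intro ξ s
      rw [hX, hF]
      by_cases k1 : ξ ∈ tsupport χ
      · by_cases k2 : s - ξ ∈ tsupport φ
        · have m1 := hR1 k1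
          have m2 := hR2 k2
          have : b s = 1 := by
            apply b.one_of_mem_closedBall
            simp only [Metric.mem_ball, dist_zero_right, Real.norm_eq_abs] at m1 m2
            simp only [Metric.mem_closedBall, dist_zero_right, Real.norm_eq_abs]
            have := abs_add_le ξ (s - ξ)
            rw [add_sub_cancel] at this
            change |s| ≤ R1 + R2
            linarith
          simp [this]
        · simp [image_eq_zero_of_notMem_tsupport k2]
      · simp [image_eq_zero_of_notMem_tsupport k1])
    (abs_decay _ hb hbs) N
  obtain ⟨C2, hC2, h2⟩ := inv_decay X N
  obtain ⟨C3, hC3, h3⟩ := abs_decay φ hφ hφs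
  refine ⟨C1 + C2 * C3, by positivity, fun u v => ?_⟩
  rw [split_eq χ φ hχ.continuous hφ.continuous hχs hφs]
  refine (norm_sub_le _ _).trans ?_
  rw [norm_mul]
  have k1 := h1 u v
  have k2 := mul_le_mul (h2 u) (h3 v) (norm_nonneg _) (by positivity)
  simp only [hX, hF] at k1 k2
  refine (add_le_add k1 k2).trans ?_
  set a := ((1 + |v|) ^ 2)⁻¹
  set b' := ((1 + |v - u|) ^ N)⁻¹
  set c := ((1 + |u|) ^ N)⁻¹
  have ha : 0 ≤ a := by positivity
  have hb' : 0 ≤ b' := by positivity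
  have hc : 0 ≤ c := by positivity
  have z1 : 0 ≤ C1 * a * c := by positivity
  have z2 : 0 ≤ C2 * C3 * a * b' := by positivity
  linarith [show (C1 + C2 * C3) * a * (b' + c) =
    C1 * a * b' + C2 * c * (C3 * a) + C1 * a * c + C2 * C3 * a * b' by ring]

end Mu2Aux

/-- **Lemma (quadratic Fourier decay of `μ₂` on a Whitney piece).** Let `ψ̃` be a smooth
function supported in `[-2,-1/2] ∪ [1/2,2]` and let `φ̃` be a smooth compactly supported
function. Set `ρ(ξ₁,η) = μ₂(ξ₁,η) ψ̃(ξ₁) φ̃(η)`. Then for every `N ∈ ℕ` there is a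
constant `C_N` such that
`|ρ̌(u,v)| ≤ C_N (1+|v|)^{-2}((1+|v-u|)^{-N} + (1+|u|)^{-N})` for all `u,v ∈ ℝ`. -/
theorem fourier_decay_of_mu2_piece
    (ψ φ : ℝ → ℝ)
    (hψ : ContDiff ℝ (⊤ : ℕ∞) ψ)
    (hψsupp : tsupport ψ ⊆ Set.Icc (-2 : ℝ) (-(1/2)) ∪ Set.Icc (1/2 : ℝ) 2)
    (hφ : ContDiff ℝ (⊤ : ℕ∞) φ) (hφsupp : HasCompactSupport φ) :
    ∀ N : ℕ, ∃ C : ℝ, 0 < C ∧ ∀ u v : ℝ,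
      ‖invFourier2 (fun p => mu2 p.1 p.2 * ψ p.1 * φ p.2) u v‖ ≤
        C * ((1 + |v|) ^ 2)⁻¹ * (((1 + |v - u|) ^ N)⁻¹ + ((1 + |u|) ^ N)⁻¹) := by

  intro N
  have h0 : (0:ℝ) ∉ tsupport ψ := fun h => by
    rcases hψsupp h with h | h
    · have := h.2; norm_num at this
    · have := h.1; norm_num at this
  have hψc : HasCompactSupport ψ :=
    (isCompact_Icc.union isCompact_Icc).of_isClosed_subset (isClosed_tsupport _) hψsupp
  have hχs : HasCompactSupport (fun x => ((ψ x / x : ℝ) : ℂ)) := by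
    apply HasCompactSupport.intro hψc.isCompact
    intro x hx
    simp [image_eq_zero_of_notMem_tsupport hx]
  have hφs : HasCompactSupport (fun x => ((φ x : ℝ) : ℂ)) :=
    hφsupp.comp_left (g := fun x : ℝ => (x : ℂ)) (by simp)
  obtain ⟨C, hC, h⟩ := Mu2Aux.main_aux (fun x => ((ψ x / x : ℝ) : ℂ)) (fun x => (φ x : ℂ))
    (Complex.ofRealCLM.contDiff.comp (Mu2Aux.contDiff_div ψ hψ h0))
    (Complex.ofRealCLM.contDiff.comp hφ) hχs hφs N
  refine ⟨C, hC, fun u v => ?_⟩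
  convert h u v using 2
  unfold invFourier2
  congr 1; ext p
  unfold Mu2Aux.E
  congr 1
  by_cases hp : p.1 = 0
  · have : ψ 0 = 0 := image_eq_zero_of_notMem_tsupport h0
    simp [hp, this]
  · beta_reduce
    rw [Mu2Aux.mu2_eq _ _ hp]
    push_cast
    ring
end

section
/- Let n ≥ 2. The function μ_n(ξ) = ∫_{[0,1]^{n-1}} sgn(α₁ξ₁ + ⋯ + α_{n-1}ξ_{n-1} + ξ_n) dα is infinitely differentiable (C^∞) on the complement in ℝⁿ of the union over α ∈ {0,1}^{n-1} of the hyperplanes {ξ ∈ ℝⁿ : α₁ξ₁ + ⋯ + α_{n-1}ξ_{n-1} + ξ_n = 0}. -/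
open MeasureTheory

/-- The symbol `μ_n` in dimension `n = m + 1`:
`μ_n(ξ) = ∫_{[0,1]^{n-1}} sgn(α₁ξ₁ + ⋯ + α_{n-1}ξ_{n-1} + ξ_n) dα`. -/
noncomputable def muSymbol (m : ℕ) (ξ : Fin (m + 1) → ℝ) : ℝ :=
  ∫ α in (Set.univ.pi fun _ : Fin m => Set.Icc (0:ℝ) 1),
    Real.sign ((∑ j : Fin m, α j * ξ j.castSucc) + ξ (Fin.last m))

/-- powers with sign -/
noncomputable def sgnPow (k : ℕ) (t : ℝ) : ℝ := Real.sign t * (t ^ k / (k.factorial : ℝ))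

lemma sgnPow_integrableOn {X : Type*} [TopologicalSpace X] [MeasurableSpace X] [OpensMeasurableSpace X]
    [T2Space X] (μ : Measure X) [IsFiniteMeasureOnCompacts μ] (K : Set X) (hK : IsCompact K)
    (k : ℕ) (L : X → ℝ) (hL : Continuous L) :
    IntegrableOn (fun x => sgnPow k (L x)) K μ := by
  unfold sgnPow
  have h1 : IntegrableOn (fun x => L x ^ k / (k.factorial : ℝ)) K μ :=
    ContinuousOn.integrableOn_compact hK (by fun_prop)
  have hs : Measurable Real.sign := by
    unfold Real.sign
    exact Measurable.ite measurableSet_Iio measurable_const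
      (Measurable.ite measurableSet_Ioi measurable_const measurable_const)
  refine Integrable.bdd_mul (c := 1) h1 (hs.comp hL.measurable).aestronglyMeasurable ?_
  refine Filter.Eventually.of_forall fun x => ?_
  rcases Real.sign_apply_eq (L x) with h | h | h <;> simp [h]

lemma sgnPow_hasDerivAt (k : ℕ) (t : ℝ) (ht : t ≠ 0) :
    HasDerivAt (sgnPow (k + 1)) (sgnPow k t) t := by
  have h0 : HasDerivAt (fun u : ℝ => Real.sign t * (u ^ (k + 1) / ((k + 1).factorial : ℝ)))
      (sgnPow k t) t := by
    have := ((hasDerivAt_pow (k + 1) t).div_const ((k + 1).factorial : ℝ)).const_mul (Real.sign t)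
    refine this.congr_deriv ?_
    unfold sgnPow
    have : (k.factorial : ℝ) ≠ 0 := by positivity
    rw [Nat.factorial_succ]
    push_cast
    field_simp
  refine h0.congr_of_eventuallyEq ?_
  rcases lt_or_gt_of_ne ht with h | h
  · filter_upwards [Iio_mem_nhds h] with u hu
    simp [sgnPow, Real.sign_of_neg h, Real.sign_of_neg hu]
  · filter_upwards [Ioi_mem_nhds h] with u hu
    simp [sgnPow, Real.sign_of_pos h, Real.sign_of_pos hu]

lemma sgnPow_contDiffAt (k : ℕ) (t : ℝ) (ht : t ≠ 0) :
    ContDiffAt ℝ (⊤ : ℕ∞) (sgnPow k) t := by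
  have h0 : ContDiffAt ℝ (⊤ : ℕ∞) (fun u : ℝ => Real.sign t * (u ^ k / (k.factorial : ℝ))) t := by
    fun_prop
  refine h0.congr_of_eventuallyEq ?_
  rcases lt_or_gt_of_ne ht with h | h
  · filter_upwards [Iio_mem_nhds h] with u hu
    simp [sgnPow, Real.sign_of_neg h, Real.sign_of_neg hu]
  · filter_upwards [Ioi_mem_nhds h] with u hu
    simp [sgnPow, Real.sign_of_pos h, Real.sign_of_pos hu]

lemma sgnPow_continuous (k : ℕ) : Continuous (sgnPow (k + 1)) := by
  have : sgnPow (k + 1) = fun t => |t| * (t ^ k / ((k + 1).factorial : ℝ)) := by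
    ext t
    unfold sgnPow
    rcases lt_trichotomy t 0 with h | h | h
    · rw [Real.sign_of_neg h, abs_of_neg h]; ring
    · simp [h]
    · rw [Real.sign_of_pos h, abs_of_pos h]; ring
  rw [this]
  fun_prop

lemma sgnPow_integral (k : ℕ) (x y : ℝ) :
    ∫ u in x..y, sgnPow k u = sgnPow (k + 1) y - sgnPow (k + 1) x := by
  refine integral_eq_of_hasDerivAt_off_countable (sgnPow (k + 1)) (sgnPow k)
    (s := {0}) (Set.countable_singleton 0) (sgnPow_continuous k).continuousOn ?_ ?_
  · intro t ht
    exact sgnPow_hasDerivAt k t (by simpa using ht.2)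
  · rw [intervalIntegrable_iff']
    exact sgnPow_integrableOn volume _ isCompact_uIcc k (fun x => x) continuous_id

/-- unit cube -/
def cube (m : ℕ) : Set (Fin m → ℝ) := Set.univ.pi fun _ : Fin m => Set.Icc (0:ℝ) 1

lemma cube_compact (m : ℕ) : IsCompact (cube m) := isCompact_univ_pi fun _ => isCompact_Icc

/-- averages -/
noncomputable def avg (m k : ℕ) (v : Fin m → ℝ) (t : ℝ) : ℝ :=
  ∫ α in cube m, sgnPow k ((∑ j : Fin m, α j * v j) + t)

lemma avg_prod (m k : ℕ) (v : Fin (m + 1) → ℝ) (t : ℝ) :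
    avg (m + 1) k v t = ∫ z in (Set.Icc (0:ℝ) 1) ×ˢ cube m,
      sgnPow k ((∑ j : Fin m, z.2 j * v j.succ) + (t + z.1 * v 0)) := by
  set e : ℝ × (Fin m → ℝ) ≃ᵐ (Fin (m + 1) → ℝ) :=
    (MeasurableEquiv.piFinSuccAbove (fun _ => ℝ) 0).symm with he
  have hem : MeasurePreserving e :=
    (volume_preserving_piFinSuccAbove (fun _ : Fin (m + 1) => ℝ) 0).symm _
  have he0 : ∀ z, e z 0 = z.1 := fun z => rfl
  have hes : ∀ z (j : Fin m), e z j.succ = z.2 j := fun z j => rfl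
  have hpre : e ⁻¹' (cube (m + 1)) = Set.Icc (0:ℝ) 1 ×ˢ cube m := by
    ext z
    simp only [cube, Set.mem_preimage, Set.mem_univ_pi, Set.mem_prod, Fin.forall_fin_succ, he0, hes]
  rw [avg, ← hem.map_eq, setIntegral_map_equiv, hpre]
  congr 1
  ext z
  congr 1
  rw [Fin.sum_univ_succ]
  simp only [he0, hes]
  ring

lemma avg_prod_int (m k : ℕ) (v : Fin (m + 1) → ℝ) (t : ℝ) :
    IntegrableOn (fun z : ℝ × (Fin m → ℝ) =>
      sgnPow k ((∑ j : Fin m, z.2 j * v j.succ) + (t + z.1 * v 0)))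
      ((Set.Icc (0:ℝ) 1) ×ˢ cube m) (volume.prod volume) :=
  sgnPow_integrableOn (volume.prod volume) _ (isCompact_Icc.prod (cube_compact m)) k
    (fun z : ℝ × (Fin m → ℝ) => (∑ j : Fin m, z.2 j * v j.succ) + (t + z.1 * v 0)) (by fun_prop)

lemma avg_succ (m k : ℕ) (v : Fin (m + 1) → ℝ) (t : ℝ) :
    avg (m + 1) k v t = ∫ a in (0:ℝ)..1, avg m k (fun j => v j.succ) (t + a * v 0) := by
  rw [avg_prod, Measure.volume_eq_prod, setIntegral_prod _ (avg_prod_int m k v t),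
    intervalIntegral.integral_of_le zero_le_one, integral_Icc_eq_integral_Ioc]
  rfl

lemma avg_succ' (m k : ℕ) (v : Fin (m + 1) → ℝ) (t : ℝ) (hv : v 0 ≠ 0) :
    avg (m + 1) k v t = (v 0)⁻¹ * (avg m (k + 1) (fun j => v j.succ) (t + v 0) -
      avg m (k + 1) (fun j => v j.succ) t) := by
  have hint := avg_prod_int m k v t
  have hi : ∀ t', IntegrableOn (fun α : Fin m → ℝ =>
      sgnPow (k + 1) ((∑ j : Fin m, α j * v j.succ) + t')) (cube m) := fun t' =>
    sgnPow_integrableOn volume _ (cube_compact m) (k + 1)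
      (fun α : Fin m → ℝ => (∑ j : Fin m, α j * v j.succ) + t') (by fun_prop)
  have hint2 : Integrable (fun z : ℝ × (Fin m → ℝ) =>
      sgnPow k ((∑ j : Fin m, z.2 j * v j.succ) + (t + z.1 * v 0)))
      ((volume.restrict (Set.Icc (0:ℝ) 1)).prod (volume.restrict (cube m))) := by
    rw [Measure.prod_restrict]
    exact hint
  have h1 : avg (m + 1) k v t = ∫ α in cube m, ∫ x in Set.Icc (0:ℝ) 1,
      sgnPow k ((∑ j : Fin m, α j * v j.succ) + (t + x * v 0)) := by
    rw [avg_prod, Measure.volume_eq_prod, ← Measure.prod_restrict]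
    exact integral_prod_symm _ hint2
  have h2 : ∀ α : Fin m → ℝ, ∫ x in Set.Icc (0:ℝ) 1,
      sgnPow k ((∑ j : Fin m, α j * v j.succ) + (t + x * v 0)) =
      (v 0)⁻¹ * (sgnPow (k + 1) ((∑ j : Fin m, α j * v j.succ) + (t + v 0)) -
        sgnPow (k + 1) ((∑ j : Fin m, α j * v j.succ) + t)) := fun α => by
    generalize (∑ j : Fin m, α j * v j.succ) = c
    rw [integral_Icc_eq_integral_Ioc, ← intervalIntegral.integral_of_le zero_le_one]
    have := intervalIntegral.integral_comp_mul_add (a := 0) (b := 1) (sgnPow k) hv (c + t)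
    rw [sgnPow_integral, smul_eq_mul] at this
    rw [show c + (t + v 0) = v 0 * 1 + (c + t) by ring]
    rw [mul_zero, zero_add] at this
    rw [← this]
    refine intervalIntegral.integral_congr fun x _ => ?_
    show sgnPow k _ = sgnPow k _
    congr 1
    ring
  rw [h1]
  simp only [h2]
  rw [integral_const_mul, integral_sub (hi _) (hi _)]
  rfl

lemma contDiff_param {P : Type*} [NormedAddCommGroup P] [NormedSpace ℝ P] (h : P × ℝ → ℝ)
    (hh : ContDiff ℝ (⊤ : ℕ∞) h) :
    ContDiff ℝ (⊤ : ℕ∞) (fun p => ∫ a in (0:ℝ)..1, h (p, a)) := by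
  let χ : ContDiffBump (0 : ℝ) := ⟨1, 2, by norm_num, by norm_num⟩
  have key := contDiffOn_convolution_right_with_param_comp (𝕜 := ℝ) (n := (⊤ : ℕ∞))
    (μ := (volume : Measure ℝ))
    (ContinuousLinearMap.mul ℝ ℝ) (s := (Set.univ : Set P)) (v := fun _ => (0:ℝ))
    (f := Set.indicator (Set.Ioc (0:ℝ) 1) (fun _ => (1:ℝ)))
    (g := fun p a => χ a * h (p, -a)) (k := Metric.closedBall 0 2) contDiffOn_const isOpen_univ
    (isCompact_closedBall _ _) ?_ ?_ ?_
  · rw [contDiffOn_univ] at key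
    convert key using 2 with p
    rw [intervalIntegral.integral_of_le zero_le_one, ← integral_indicator measurableSet_Ioc]
    unfold convolution
    congr 1
    ext a
    by_cases ha : a ∈ Set.Ioc (0:ℝ) 1
    · have : χ (0 - a) = 1 := by
        apply χ.one_of_mem_closedBall
        simp only [zero_sub, Metric.mem_closedBall, dist_zero_right, norm_neg, Real.norm_eq_abs]
        rw [abs_of_pos ha.1]; exact ha.2
      simp only [Set.indicator_of_mem ha, ContinuousLinearMap.mul_apply', this]
      simp
    · simp [Set.indicator_of_notMem ha]
  · intro p x _ hx
    have : χ x = 0 := by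
      apply χ.zero_of_le_dist
      simp only [Metric.mem_closedBall, not_le] at hx
      exact hx.le
    simp [this]
  · exact ((integrable_indicator_iff measurableSet_Ioc).2
      (integrable_const (μ := volume.restrict (Set.Ioc (0:ℝ) 1)) (1:ℝ))).locallyIntegrable
  · apply ContDiff.contDiffOn
    have h1 : ContDiff ℝ (⊤ : ℕ∞) (fun a : ℝ => χ a) := χ.contDiff
    exact (h1.comp contDiff_snd).mul (hh.comp (contDiff_fst.prodMk contDiff_snd.neg))

lemma contDiffAt_extend {P : Type*} [NormedAddCommGroup P] [NormedSpace ℝ P]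
    [FiniteDimensional ℝ P] (g : P → ℝ) (x : P)
    (hn : ∀ᶠ y in nhds x, ContDiffAt ℝ (⊤ : ℕ∞) g y) :
    ∃ G : P → ℝ, ContDiff ℝ (⊤ : ℕ∞) G ∧ ∀ᶠ y in nhds x, G y = g y := by
  obtain ⟨ε, hε, hb⟩ := Metric.eventually_nhds_iff.1 hn
  let χ : ContDiffBump x := ⟨ε / 4, ε / 2, by positivity, by linarith⟩
  refine ⟨fun y => χ y * g y, ?_, ?_⟩
  · rw [contDiff_iff_contDiffAt]
    intro y
    by_cases hy : dist y x < ε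
    · exact χ.contDiffAt.mul (hb hy)
    · have : (fun y => χ y * g y) =ᶠ[nhds y] fun _ => 0 := by
        have : ∀ᶠ z in nhds y, ε / 2 < dist z x := by
          apply (continuous_id.dist continuous_const).continuousAt.eventually (lt_mem_nhds _)
          simp only [id]; linarith
        filter_upwards [this] with z hz
        rw [χ.zero_of_le_dist hz.le, zero_mul]
      exact contDiffAt_const.congr_of_eventuallyEq this
  · filter_upwards [χ.eventuallyEq_one] with y hy
    simp [hy]

/-- good set -/
def good (m : ℕ) (v : Fin m → ℝ) (t : ℝ) : Prop :=
  ∀ α : Fin m → ℝ, (∀ j, α j = 0 ∨ α j = 1) → (∑ j : Fin m, α j * v j) + t ≠ 0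

lemma good_isOpen (m : ℕ) : IsOpen {p : (Fin m → ℝ) × ℝ | good m p.1 p.2} := by
  have : {p : (Fin m → ℝ) × ℝ | good m p.1 p.2} =
      ⋂ α ∈ (Set.univ.pi fun _ : Fin m => ({0, 1} : Set ℝ)),
        {p : (Fin m → ℝ) × ℝ | (∑ j : Fin m, α j * p.1 j) + p.2 ≠ 0} := by
    ext p
    simp [good]
  rw [this]
  refine Set.Finite.isOpen_biInter (Set.Finite.pi fun _ => Set.toFinite _) ?_
  intro α _
  exact isOpen_ne_fun (by fun_prop) continuous_const

lemma good_succ (m : ℕ) (v : Fin (m + 1) → ℝ) (t : ℝ) (h : good (m + 1) v t) :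
    good m (fun j => v j.succ) t ∧ good m (fun j => v j.succ) (t + v 0) := by
  constructor
  · intro α hα
    have := h (Fin.cons 0 α) (by
      intro j; refine Fin.cases ?_ (fun i => ?_) j <;> simp [hα])
    simpa [Fin.sum_univ_succ] using this
  · intro α hα
    have := h (Fin.cons 1 α) (by
      intro j; refine Fin.cases ?_ (fun i => ?_) j <;> simp [hα])
    rw [Fin.sum_univ_succ] at this
    simp only [Fin.cons_zero, Fin.cons_succ] at this
    convert this using 1
    ring

lemma avg_smooth (m : ℕ) : ∀ (k : ℕ) (p : (Fin m → ℝ) × ℝ), good m p.1 p.2 →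
    ContDiffAt ℝ (⊤ : ℕ∞) (fun q : (Fin m → ℝ) × ℝ => avg m k q.1 q.2) p := by
  induction m with
  | zero =>
    intro k p hp
    have h0 : p.2 ≠ 0 := by simpa using hp 0 (fun j => j.elim0)
    have : (fun q : (Fin 0 → ℝ) × ℝ => avg 0 k q.1 q.2) = fun q => sgnPow k q.2 := by
      ext q
      have hc : cube 0 = Set.univ := by ext; simp [cube]
      simp [avg, hc, Measure.volume_pi_eq_dirac (0 : Fin 0 → ℝ)]
    rw [this]
    exact (sgnPow_contDiffAt k _ h0).comp p contDiffAt_snd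
  | succ m ih =>
    rintro k ⟨v, t⟩ hp
    obtain ⟨g1, g2⟩ := good_succ m v t hp
    by_cases hv : v 0 = 0
    · obtain ⟨G, hG, hGe⟩ := contDiffAt_extend _ ((fun j => v j.succ, t) : (Fin m → ℝ) × ℝ)
        (by
          filter_upwards [(good_isOpen m).mem_nhds g1] with y hy
          exact ih k y hy)
      have hs : ContDiff ℝ (⊤ : ℕ∞) (fun q : (Fin (m + 1) → ℝ) × ℝ =>
          ∫ a in (0:ℝ)..1, G (fun j => q.1 j.succ, q.2 + a * q.1 0)) := by
        refine contDiff_param (fun z : ((Fin (m + 1) → ℝ) × ℝ) × ℝ =>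
          G (fun j => z.1.1 j.succ, z.1.2 + z.2 * z.1.1 0)) (hG.comp ?_)
        fun_prop
      refine hs.contDiffAt.congr_of_eventuallyEq ?_
      obtain ⟨ε, hε, hb⟩ := Metric.eventually_nhds_iff.1 hGe
      filter_upwards [Metric.ball_mem_nhds _ (half_pos hε)] with q hq
      rw [avg_succ]
      refine intervalIntegral.integral_congr fun a ha => ?_
      rw [Set.uIcc_of_le zero_le_one] at ha
      refine (hb (y := (fun j => q.1 j.succ, q.2 + a * q.1 0)) ?_).symm
      rw [Metric.mem_ball, Prod.dist_eq, max_lt_iff] at hq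
      have hc : ∀ j, dist (q.1 j) (v j) < ε / 2 := fun j => (dist_le_pi_dist _ _ j).trans_lt hq.1
      rw [Prod.dist_eq, max_lt_iff]
      constructor
      · rw [dist_pi_lt_iff hε]
        intro j
        have := hc j.succ
        simp only
        linarith
      · have h0 := hc 0
        have h1 := hq.2
        simp only [hv, Real.dist_eq, sub_zero] at h0 h1 ⊢
        have h2 : |a * q.1 0| ≤ |q.1 0| := by
          rw [abs_mul, abs_of_nonneg ha.1]
          exact mul_le_of_le_one_left (abs_nonneg _) ha.2
        rw [show q.2 + a * q.1 0 - t = (q.2 - t) + a * q.1 0 by ring]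
        linarith [abs_add_le (q.2 - t) (a * q.1 0)]
    · have e : (fun q : (Fin (m + 1) → ℝ) × ℝ => avg (m + 1) k q.1 q.2) =ᶠ[nhds (v, t)]
          fun q => (q.1 0)⁻¹ * (avg m (k + 1) (fun j => q.1 j.succ) (q.2 + q.1 0) -
            avg m (k + 1) (fun j => q.1 j.succ) q.2) := by
        have : ∀ᶠ q : (Fin (m + 1) → ℝ) × ℝ in nhds (v, t), q.1 0 ≠ 0 :=
          (isOpen_ne_fun (f := fun q : (Fin (m + 1) → ℝ) × ℝ => q.1 0)
            (by fun_prop) continuous_const).mem_nhds hv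
        filter_upwards [this] with q hq
        exact avg_succ' m k q.1 q.2 hq
      refine ContDiffAt.congr_of_eventuallyEq ?_ e
      refine ContDiffAt.mul (ContDiffAt.inv (by fun_prop) hv) (ContDiffAt.sub ?_ ?_)
      · exact ContDiffAt.comp (v, t) (g := fun q : (Fin m → ℝ) × ℝ => avg m (k + 1) q.1 q.2)
          (f := fun q : (Fin (m + 1) → ℝ) × ℝ => (fun j => q.1 j.succ, q.2 + q.1 0))
          (ih (k + 1) _ g2) (by fun_prop)
      · exact ContDiffAt.comp (v, t) (g := fun q : (Fin m → ℝ) × ℝ => avg m (k + 1) q.1 q.2)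
          (f := fun q : (Fin (m + 1) → ℝ) × ℝ => (fun j => q.1 j.succ, q.2))
          (ih (k + 1) _ g1) (by fun_prop)

/-- **Lemma.** For `n = d + 2 ≥ 2`, the function `μ_n` is infinitely differentiable on
the complement in `ℝⁿ` of the union over `α ∈ {0,1}^{n-1}` of the hyperplanes
`{ξ ∈ ℝⁿ : α₁ξ₁ + ⋯ + α_{n-1}ξ_{n-1} + ξ_n = 0}`. -/
theorem mu_smooth_off_bad_hyperplanes (d : ℕ) :
    ContDiffOn ℝ (⊤ : ℕ∞) (muSymbol (d + 1))
      {ξ : Fin (d + 2) → ℝ | ∀ α : Fin (d + 1) → ℝ, (∀ j, α j = 0 ∨ α j = 1) →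
        (∑ j : Fin (d + 1), α j * ξ j.castSucc) + ξ (Fin.last (d + 1)) ≠ 0} := by
  intro ξ hξ
  apply ContDiffAt.contDiffWithinAt
  have h := avg_smooth (d + 1) 0 (fun j => ξ j.castSucc, ξ (Fin.last (d + 1))) hξ
  have e : muSymbol (d + 1) = fun ξ : Fin (d + 2) → ℝ =>
      avg (d + 1) 0 (fun j => ξ j.castSucc) (ξ (Fin.last (d + 1))) := by
    ext ξ
    simp [muSymbol, avg, cube, sgnPow]
  rw [e]
  exact ContDiffAt.comp ξ (g := fun q : (Fin (d + 1) → ℝ) × ℝ => avg (d + 1) 0 q.1 q.2)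
    (f := fun ξ : Fin (d + 2) → ℝ => (fun j => ξ j.castSucc, ξ (Fin.last (d + 1)))) h (by fun_prop)
end

section
/- Let n ≥ 2 and j₀ ∈ {1, …, n}. For N ≥ 2, define F₀(x) = 1_{(0,1)}(x_{j₀}) ∏_{j ≠ j₀} 1_{(0,N)}(x_j), F_{j₀}(x) = 1_{(0,∞)}(x_{j₀}), and F_j(x) = 1_{(0,1)}(x_{j₀}) ∏_{ℓ ≠ j₀} 1_{(−N,N)}(x_ℓ) for j ∈ {1, …, n}∖{j₀}. Then there exist constants c₁, c₂ ∈ (0, ∞), depending only on n, such that for all sufficiently large N the form satisfies c₁ N^{n−1} log N ≤ Λ^{(n)}(F₀, …, F_n) ≤ c₂ N^{n−1} log N. -/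
open MeasureTheory

/-- Truncated averaged simplex Hilbert transform form `Λ^{(n)}` in dimension `n = d + 2`
(real-valued version):
`∫_{ℝⁿ} ∫_{|t|>ε} ∫_{[0,1]^{n-1}} F₀(x) (∏_{j=1}^{n-1} F_j(x+tα_j e_j)) F_n(x+te_n) dα dt/t dx`. -/
noncomputable def simplexTruncR (d : ℕ) (F : ℕ → (Fin (d + 2) → ℝ) → ℝ) (ε : ℝ) : ℝ :=
  ∫ x : Fin (d + 2) → ℝ,
    ∫ t in {t : ℝ | ε < |t|},
      (∫ α in (Set.univ.pi fun _ : Fin (d + 1) => Set.Icc (0:ℝ) 1),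
        F 0 x *
          (∏ j : Fin (d + 1), F (j.1 + 1) (x + Pi.single j.castSucc (t * α j))) *
          F (d + 2) (x + Pi.single (Fin.last (d + 1)) t)) / t

/-- `Λ^{(n)}(F₀,…,F_n) = L` in the principal value sense, for `n = d + 2`. -/
def HasSimplexFormR (d : ℕ) (F : ℕ → (Fin (d + 2) → ℝ) → ℝ) (L : ℝ) : Prop :=
  Filter.Tendsto (simplexTruncR d F) (nhdsWithin 0 (Set.Ioi 0)) (nhds L)


lemma inv_sq_int {a : ℝ} (ha : 0 < a) : IntegrableOn (fun t : ℝ => 1 / t ^ 2) (Set.Ioi a) := by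
  have := integrableOn_Ioi_rpow_of_lt (show (-2:ℝ) < -1 by norm_num) ha
  refine this.congr_fun (fun x hx => ?_) measurableSet_Ioi
  have hx0 : 0 < x := ha.trans hx
  simp [Real.rpow_neg hx0.le]

lemma inv_sq_val {a : ℝ} (ha : 0 < a) : ∫ t in Set.Ioi a, 1 / t ^ 2 = 1 / a := by
  have := integral_Ioi_rpow_of_lt (show (-2:ℝ) < -1 by norm_num) ha
  rw [show (-2:ℝ) + 1 = -1 by norm_num, Real.rpow_neg_one] at this
  have h2 : ∫ t in Set.Ioi a, 1 / t ^ 2 = ∫ t in Set.Ioi a, t ^ (-2:ℝ) := by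
    refine setIntegral_congr_fun measurableSet_Ioi (fun x hx => ?_)
    have hx0 : 0 < x := ha.trans hx
    simp [Real.rpow_neg hx0.le]
  rw [h2, this]; field_simp

lemma inv_int {R : ℝ} (hR : 1 ≤ R) : IntegrableOn (fun t : ℝ => 1 / t) (Set.Ioc 1 R) := by
  rw [← intervalIntegrable_iff_integrableOn_Ioc_of_le hR]
  refine intervalIntegral.intervalIntegrable_one_div (fun x hx => ?_) continuousOn_id
  rw [Set.uIcc_of_le hR] at hx
  have := hx.1
  simp; linarith

lemma inv_val {R : ℝ} (hR : 1 ≤ R) : ∫ t in Set.Ioc 1 R, 1 / t = Real.log R := by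
  rw [← intervalIntegral.integral_of_le hR, integral_one_div_of_pos one_pos (by linarith)]
  simp

set_option maxHeartbeats 1000000 in
lemma lemA (Φ : ℝ → ℝ) (hm : Measurable Φ) (N M C q : ℝ) (hN : 2 ≤ N) (hM : 0 ≤ M)
    (hC : 0 ≤ C) (h0 : ∀ t, 0 ≤ Φ t) (h1 : ∀ t, Φ t ≤ M)
    (h2 : ∀ t, |t| ≤ 1 → M * (1 - C * |t|) ≤ Φ t)
    (h3 : ∀ t, Φ t * |t| ≤ 2 * N * M)
    (h4 : ∀ t, 1 ≤ t → Φ (-t) * t ≤ M)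
    (h5 : ∀ t, 0 < t → t ≤ N / 2 → q * M ≤ Φ t) :
    ∃ L : ℝ, Filter.Tendsto (fun ε => ∫ t in {t : ℝ | ε < |t|}, Φ t / t)
      (nhdsWithin 0 (Set.Ioi 0)) (nhds L) ∧
      M * (q * Real.log (N / 2) - C - 1) ≤ L ∧ L ≤ M * (C + Real.log N + 2) := by
  set D : ℝ → ℝ := fun t => (Φ t - Φ (-t)) / t with hD
  have hDm : Measurable D := by fun_prop
  have b1 : ∀ t ∈ Set.Ioc (0:ℝ) 1, |D t| ≤ C * M := by
    intro t ht
    have ha : |t| = t := abs_of_pos ht.1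
    have e1 := h2 t (by rw [ha]; exact ht.2)
    have e2 := h2 (-t) (by rw [abs_neg, ha]; exact ht.2)
    rw [abs_neg] at e2
    rw [ha] at e1 e2
    simp only [hD]
    rw [abs_div, ha, div_le_iff₀ ht.1, abs_le]
    constructor <;> nlinarith [h1 t, h1 (-t)]
  have b2 : ∀ t, 0 < t → |D t| ≤ 2 * N * M * (1 / t ^ 2) := by
    intro t ht
    have ha : |t| = t := abs_of_pos ht
    have e1 := h3 t
    have e2 := h3 (-t)
    rw [abs_neg] at e2
    rw [ha] at e1 e2
    simp only [hD]
    rw [abs_div, ha, mul_one_div, div_le_div_iff₀ ht (by positivity)]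
    have : |Φ t - Φ (-t)| * t ≤ 2 * N * M := by
      rw [← abs_of_pos ht, ← abs_mul, abs_of_pos ht, abs_le]
      constructor <;> nlinarith [mul_nonneg (h0 t) ht.le, mul_nonneg (h0 (-t)) ht.le]
    nlinarith
  have i1 : IntegrableOn D (Set.Ioc 0 1) := by
    refine Integrable.mono' (g := fun _ => C * M) (integrableOn_const (by simp)) hDm.aestronglyMeasurable ?_
    exact (ae_restrict_mem measurableSet_Ioc).mono b1
  have i2 : ∀ a, 0 < a → IntegrableOn D (Set.Ioi a) := by
    intro a ha
    refine Integrable.mono' (g := fun t => 2 * N * M * (1 / t ^ 2))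
      ((inv_sq_int ha).const_mul _) hDm.aestronglyMeasurable ?_
    exact (ae_restrict_mem measurableSet_Ioi).mono fun t ht => b2 t (ha.trans ht)
  have i0 : IntegrableOn D (Set.Ioi 0) := by
    rw [← Set.Ioc_union_Ioi_eq_Ioi (zero_le_one (α := ℝ))]
    exact i1.union (i2 1 one_pos)
  have s1 : ∫ t in Set.Ioi 0, D t = (∫ t in Set.Ioc 0 1, D t) + ∫ t in Set.Ioi 1, D t := by
    rw [← Set.Ioc_union_Ioi_eq_Ioi (zero_le_one (α := ℝ)),
      setIntegral_union (Set.Ioc_disjoint_Ioi le_rfl) measurableSet_Ioi i1 (i2 1 one_pos)]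
  have p1 : |∫ t in Set.Ioc 0 1, D t| ≤ C * M := by
    have := norm_setIntegral_le_of_norm_le_const (μ := volume) (f := D) (C := C * M)
      (s := Set.Ioc (0:ℝ) 1) (by simp) b1
    simpa using this
  rw [abs_le] at p1
  refine ⟨∫ t in Set.Ioi 0, D t, ?_, ?_, ?_⟩
  · have hc : AECover (volume.restrict (Set.Ioi (0:ℝ))) (nhdsWithin 0 (Set.Ioi 0))
        (fun ε : ℝ => Set.Ioi ε) := aecover_Ioi_of_Ioi (Filter.tendsto_id.mono_left nhdsWithin_le_nhds)
    have := hc.integral_tendsto_of_countably_generated i0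
    refine this.congr' ?_
    filter_upwards [self_mem_nhdsWithin] with ε hε
    have hε : 0 < ε := hε
    have hset : {t : ℝ | ε < |t|} = Set.Iio (-ε) ∪ Set.Ioi ε := by
      ext t; simp only [Set.mem_ofPred_eq, lt_abs, Set.mem_union, Set.mem_Iio, Set.mem_Ioi]; constructor
      · rintro (h | h); exacts [Or.inr h, Or.inl (by linarith)]
      · rintro (h | h); exacts [Or.inr (by linarith), Or.inl h]
    have j1 : IntegrableOn (fun t => Φ t / t) (Set.Ioi ε) := by
      refine Integrable.mono' (g := fun t => 2 * N * M * (1 / t ^ 2))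
        ((inv_sq_int hε).const_mul _) (hm.div measurable_id).aestronglyMeasurable ?_
      refine (ae_restrict_mem measurableSet_Ioi).mono fun t ht => ?_
      have ht : 0 < t := hε.trans ht
      rw [Real.norm_of_nonneg (div_nonneg (h0 t) ht.le), mul_one_div,
        div_le_div_iff₀ ht (by positivity)]
      have := h3 t
      rw [abs_of_pos ht] at this
      nlinarith
    have j2 : IntegrableOn (fun t => Φ (-t) / -t) (Set.Ioi ε) := by
      have : (fun t => Φ (-t) / -t) = fun t => D t - Φ t / t := by
        ext t; simp only [hD]; ring
      rw [this]; exact (i2 ε hε).sub j1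
    have j2' : IntegrableOn (fun t => Φ t / t) (Set.Iio (-ε)) := by
      have h := IntegrableOn.comp_neg_Iio (c := -ε) (f := fun t => Φ (-t) / -t)
        (by rw [neg_neg]; exact j2)
      simp only [neg_neg] at h
      exact h
    rw [Measure.restrict_restrict measurableSet_Ioi, Set.inter_eq_left.2 (Set.Ioi_subset_Ioi hε.le),
      hset, setIntegral_union _ measurableSet_Ioi j2' j1]
    · have : ∫ t in Set.Iio (-ε), Φ t / t = ∫ t in Set.Ioi ε, Φ (-t) / -t := by
        rw [integral_comp_neg_Ioi ε (fun t => Φ t / t), integral_Iic_eq_integral_Iio]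
      rw [this, ← integral_add j2 j1]
      refine integral_congr_ae (Filter.Eventually.of_forall fun t => ?_)
      simp only [hD]; ring
    · rw [Set.disjoint_left]; intro t ht ht'
      simp at ht ht'; linarith
  · have hR : 1 ≤ N / 2 := by linarith
    have q1 : ∀ t ∈ Set.Ioi (1:ℝ), 0 ≤ D t + M * (1 / t ^ 2) := by
      intro t ht
      have ht1 : 1 < t := ht
      have ht : 0 < t := by linarith
      have : D t + M * (1 / t ^ 2) = (Φ t + (M - Φ (-t) * t) / t) / t := by
        simp only [hD]; field_simp; ring
      rw [this]
      have := h4 t ht1.le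
      exact div_nonneg (add_nonneg (h0 t) (div_nonneg (by linarith) ht.le)) ht.le
    have q2 : ∀ t ∈ Set.Ioc (1:ℝ) (N / 2), q * M * (1 / t) ≤ D t + M * (1 / t ^ 2) := by
      intro t ht
      have ht1 : 1 < t := ht.1
      have ht0 : 0 < t := by linarith
      have e : D t + M * (1 / t ^ 2) = (Φ t + (M - Φ (-t) * t) / t) / t := by
        simp only [hD]; field_simp; ring
      rw [e, mul_one_div]
      have := h4 t ht1.le
      have := h5 t ht0 ht.2
      gcongr
      have : 0 ≤ (M - Φ (-t) * t) / t := (div_nonneg (by linarith) ht0.le)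
      linarith
    have hi : IntegrableOn (fun t => D t + M * (1 / t ^ 2)) (Set.Ioi 1) :=
      (i2 1 one_pos).add ((inv_sq_int one_pos).const_mul M)
    have k1 : ∫ t in Set.Ioc 1 (N/2), (D t + M * (1 / t ^ 2)) ≤
        ∫ t in Set.Ioi 1, (D t + M * (1 / t ^ 2)) :=
      setIntegral_mono_set hi ((ae_restrict_mem measurableSet_Ioi).mono q1)
        (Filter.Eventually.of_forall Set.Ioc_subset_Ioi_self)
    have k2 : ∫ t in Set.Ioc 1 (N/2), q * M * (1 / t) ≤
        ∫ t in Set.Ioc 1 (N/2), (D t + M * (1 / t ^ 2)) :=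
      setIntegral_mono_on ((inv_int hR).const_mul _) (hi.mono_set Set.Ioc_subset_Ioi_self)
        measurableSet_Ioc q2
    rw [integral_const_mul, inv_val hR] at k2
    rw [integral_add (i2 1 one_pos) ((inv_sq_int one_pos).const_mul M), integral_const_mul,
      inv_sq_val one_pos] at k1
    rw [s1]
    linarith [p1.1]
  · have hR : 1 ≤ N := by linarith
    have hN0 : 0 < N := by linarith
    have s2 : ∫ t in Set.Ioi 1, D t = (∫ t in Set.Ioc 1 N, D t) + ∫ t in Set.Ioi N, D t := by
      rw [← Set.Ioc_union_Ioi_eq_Ioi hR,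
        setIntegral_union (Set.Ioc_disjoint_Ioi le_rfl) measurableSet_Ioi
          ((i2 1 one_pos).mono_set Set.Ioc_subset_Ioi_self) (i2 N hN0)]
    have k1 : ∫ t in Set.Ioc 1 N, D t ≤ ∫ t in Set.Ioc 1 N, M * (1 / t) := by
      refine setIntegral_mono_on ((i2 1 one_pos).mono_set Set.Ioc_subset_Ioi_self)
        ((inv_int hR).const_mul _) measurableSet_Ioc fun t ht => ?_
      have ht0 : 0 < t := by linarith [ht.1]
      rw [mul_one_div]
      simp only [hD]
      gcongr
      linarith [h1 t, h0 (-t)]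
    have k2 : ∫ t in Set.Ioi N, D t ≤ ∫ t in Set.Ioi N, 2 * N * M * (1 / t ^ 2) := by
      refine setIntegral_mono_on (i2 N hN0)
        ((inv_sq_int hN0).const_mul _) measurableSet_Ioi fun t ht => ?_
      exact (le_abs_self _).trans (b2 t (hN0.trans ht))
    rw [integral_const_mul, inv_val hR] at k1
    rw [integral_const_mul, inv_sq_val hN0] at k2
    have : 2 * N * M * (1 / N) = 2 * M := by field_simp
    rw [s1, s2]
    linarith [p1.2]


noncomputable def kk (μ : Measure ℝ) (I S : Set ℝ) (x t : ℝ) : ℝ :=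
  I.indicator (fun x => μ.real ((fun α => x + t * α) ⁻¹' S)) x

noncomputable def mu {d : ℕ} (j : Fin (d + 2)) : Measure ℝ :=
  if j = Fin.last (d + 1) then Measure.dirac 1 else volume.restrict (Set.Icc 0 1)

noncomputable def II {d : ℕ} (N : ℝ) (i j : Fin (d + 2)) : Set ℝ :=
  if j = i then Set.Ioo 0 1 else Set.Ioo 0 N

noncomputable def SS {d : ℕ} (N : ℝ) (i j : Fin (d + 2)) : Set ℝ :=
  if j = i then Set.Ioi 0 else Set.Ioo (-N) N

noncomputable def VV {d : ℕ} (N : ℝ) (i j : Fin (d + 2)) : ℝ := if j = i then 1 else N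

noncomputable def ph {d : ℕ} (N : ℝ) (i j : Fin (d + 2)) (t : ℝ) : ℝ :=
  ∫ x, kk (mu j) (II N i j) (SS N i j) x t

instance mu_prob {d : ℕ} (j : Fin (d + 2)) : IsProbabilityMeasure (mu j) := by
  unfold mu; split_ifs
  · infer_instance
  · exact ⟨by simp⟩

lemma mu_ae {d : ℕ} (j : Fin (d + 2)) : ∀ᵐ α ∂(mu j), α ∈ Set.Icc (0:ℝ) 1 := by
  unfold mu; split_ifs
  · exact (ae_dirac_iff measurableSet_Icc).2 (by simp)
  · exact ae_restrict_mem measurableSet_Icc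

lemma II_meas {d : ℕ} (N : ℝ) (i j : Fin (d + 2)) : MeasurableSet (II N i j) := by
  unfold II; split_ifs <;> exact measurableSet_Ioo

lemma SS_meas {d : ℕ} (N : ℝ) (i j : Fin (d + 2)) : MeasurableSet (SS N i j) := by
  unfold SS; split_ifs
  · exact measurableSet_Ioi
  · exact measurableSet_Ioo

lemma II_vol {d : ℕ} {N : ℝ} (hN : 0 ≤ N) (i j : Fin (d + 2)) :
    volume.real (II N i j) = VV N i j := by
  unfold II VV; split_ifs <;> simp [Measure.real, hN]

lemma II_fin {d : ℕ} (N : ℝ) (i j : Fin (d + 2)) : volume (II N i j) ≠ ⊤ := by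
  unfold II; split_ifs <;> simp

lemma kk_meas {d : ℕ} (N : ℝ) (i j : Fin (d + 2)) :
    Measurable (fun p : ℝ × ℝ => kk (mu j) (II N i j) (SS N i j) p.1 p.2) := by
  have h : Measurable (fun p : ℝ × ℝ => (mu j).real ((fun α => p.1 + p.2 * α) ⁻¹' (SS N i j))) := by
    have hs : MeasurableSet {q : (ℝ × ℝ) × ℝ | q.1.1 + q.1.2 * q.2 ∈ SS N i j} :=
      (show Measurable (fun q : (ℝ × ℝ) × ℝ => q.1.1 + q.1.2 * q.2) by fun_prop) (SS_meas N i j)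
    exact (measurable_measure_prodMk_left (ν := mu j) hs).ennreal_toReal
  exact h.indicator (measurable_fst (II_meas N i j))

lemma kk_nonneg (μ : Measure ℝ) (I S : Set ℝ) (x t : ℝ) : 0 ≤ kk μ I S x t := by
  unfold kk; exact Set.indicator_nonneg (fun _ _ => measureReal_nonneg) _

lemma kk_le (μ : Measure ℝ) [IsProbabilityMeasure μ] (I S : Set ℝ) (x t : ℝ) :
    kk μ I S x t ≤ I.indicator 1 x := by
  unfold kk
  exact Set.indicator_le_indicator measureReal_le_one

lemma kk_int {d : ℕ} (N : ℝ) (i j : Fin (d + 2)) (t : ℝ) :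
    Integrable (fun x => kk (mu j) (II N i j) (SS N i j) x t) := by
  refine Integrable.mono' (g := (II N i j).indicator 1) ?_ ?_ ?_
  · rw [integrable_indicator_iff (II_meas N i j)]
    exact integrableOn_const (II_fin N i j)
  · exact ((kk_meas N i j).comp (by fun_prop : Measurable fun x : ℝ => (x, t))).aestronglyMeasurable
  · refine Filter.Eventually.of_forall fun x => ?_
    rw [Real.norm_of_nonneg (kk_nonneg _ _ _ _ _)]
    exact kk_le _ _ _ _ _

lemma ph_nonneg {d : ℕ} (N : ℝ) (i j : Fin (d + 2)) (t : ℝ) : 0 ≤ ph N i j t :=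
  integral_nonneg fun _ => kk_nonneg _ _ _ _ _

lemma ph_le_c {d : ℕ} {N : ℝ} (hN : 0 ≤ N) (i j : Fin (d + 2)) (t c : ℝ)
    (h : ∀ x ∈ II N i j, kk (mu j) (II N i j) (SS N i j) x t ≤ c) :
    ph N i j t ≤ c * VV N i j := by
  have h1 : ph N i j t ≤ ∫ x, (II N i j).indicator (fun _ => c) x := by
    refine integral_mono (kk_int N i j t) ?_ fun x => ?_
    · rw [integrable_indicator_iff (II_meas N i j)]
      exact integrableOn_const (II_fin N i j)
    · by_cases hx : x ∈ II N i j
      · simp only [Set.indicator_of_mem hx]; exact h x hx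
      · simp [kk, hx]
  rw [integral_indicator_const _ (II_meas N i j), II_vol hN, smul_eq_mul, mul_comm] at h1
  exact h1

lemma ph_le {d : ℕ} {N : ℝ} (hN : 0 ≤ N) (i j : Fin (d + 2)) (t : ℝ) :
    ph N i j t ≤ VV N i j := by
  have := ph_le_c hN i j t 1 fun x hx => by
    have := kk_le (mu j) (II N i j) (SS N i j) x t
    simpa [hx] using this
  simpa using this

lemma le_ph {d : ℕ} (N : ℝ) (i j : Fin (d + 2)) (t a b : ℝ)
    (hJ : Set.Ioo a b ⊆ II N i j)
    (h : ∀ x ∈ Set.Ioo a b, ∀ α ∈ Set.Icc (0:ℝ) 1, x + t * α ∈ SS N i j) :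
    b - a ≤ ph N i j t := by
  have h1 : ∫ x, (Set.Ioo a b).indicator 1 x ≤ ph N i j t := by
    refine integral_mono ?_ (kk_int N i j t) fun x => ?_
    · rw [integrable_indicator_iff measurableSet_Ioo]
      exact integrableOn_const (by simp)
    · by_cases hx : x ∈ Set.Ioo a b
      · have : (mu j) ((fun α => x + t * α) ⁻¹' (SS N i j)) = 1 := by
          rw [← measure_univ (μ := mu j)]
          refine measure_congr ?_
          filter_upwards [mu_ae j] with α hα
          exact propext ⟨fun _ => trivial, fun _ => h x hx α hα⟩
        simp [kk, hJ hx, hx, Measure.real, this]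
      · simp only [Set.indicator_of_notMem hx]; exact kk_nonneg _ _ _ _ _
  rw [integral_indicator_one measurableSet_Ioo] at h1
  refine le_trans ?_ h1
  simp [Measure.real, ENNReal.toReal_ofReal']

lemma ph_lip {d : ℕ} {N : ℝ} (hN : 1 ≤ N) (i j : Fin (d + 2)) (t : ℝ) (ht : |t| ≤ 1) :
    VV N i j * (1 - |t|) ≤ ph N i j t := by
  have h0 := abs_nonneg t
  have hb : ∀ α ∈ Set.Icc (0:ℝ) 1, |t * α| ≤ |t| := by
    intro α hα
    rw [abs_mul, abs_of_nonneg hα.1]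
    exact mul_le_of_le_one_right h0 hα.2
  by_cases hj : j = i
  · have := le_ph N i j t |t| 1 (by
      simp only [II, hj, if_true]; exact Set.Ioo_subset_Ioo_left h0) (by
      intro x hx α hα
      simp only [SS, hj, if_true, Set.mem_Ioi]
      have := (abs_le.1 (hb α hα)).1
      linarith [hx.1])
    simpa [VV, hj] using this
  · have := le_ph N i j t 0 (N - |t|) (by
      simp only [II, hj, if_false]; exact Set.Ioo_subset_Ioo_right (by linarith)) (by
      intro x hx α hα
      simp only [SS, hj, if_false, Set.mem_Ioo]
      have := (abs_le.1 (hb α hα))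
      constructor <;> linarith [hx.1, hx.2])
    simp only [VV, hj, if_false]
    nlinarith

lemma ph_half {d : ℕ} {N : ℝ} (hN : 1 ≤ N) (i j : Fin (d + 2)) (t : ℝ) (ht : 0 < t)
    (ht' : t ≤ N / 2) : VV N i j * (1 / 2) ≤ ph N i j t := by
  have hb : ∀ α ∈ Set.Icc (0:ℝ) 1, 0 ≤ t * α ∧ t * α ≤ t := by
    intro α hα
    exact ⟨mul_nonneg ht.le hα.1, mul_le_of_le_one_right ht.le hα.2⟩
  by_cases hj : j = i
  · have := le_ph N i j t 0 1 (by simp [II, hj]) (by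
      intro x hx α hα
      simp only [SS, hj, if_true, Set.mem_Ioi]
      linarith [hx.1, (hb α hα).1])
    simp only [VV, hj, if_true]
    subst hj
    linarith
  · have := le_ph N i j t 0 (N / 2) (by
      simp only [II, hj, if_false]; exact Set.Ioo_subset_Ioo_right (by linarith)) (by
      intro x hx α hα
      simp only [SS, hj, if_false, Set.mem_Ioo]
      have := hb α hα
      constructor <;> linarith [hx.1, hx.2])
    simp only [VV, hj, if_false]
    linarith

lemma kk_decay {d : ℕ} {N : ℝ} (hN : 1 ≤ N) (i j : Fin (d + 2)) (hj : j ≠ i) (x t : ℝ) :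
    kk (mu j) (II N i j) (SS N i j) x t * |t| ≤ 2 * N := by
  by_cases hx : x ∈ II N i j
  swap
  · simp [kk, hx]; linarith
  rcases eq_or_ne t 0 with rfl | ht
  · simp; linarith
  have ht0 : 0 < |t| := abs_pos.2 ht
  rw [← le_div_iff₀ ht0]
  have hx' : x ∈ Set.Ioo 0 N := by simpa [II, hj] using hx
  simp only [kk, hx, Set.indicator_of_mem, SS, hj, if_false]
  by_cases hl : j = Fin.last (d + 1)
  · simp only [mu, hl, if_true, Measure.real]
    rw [Measure.dirac_apply' _ ((show Measurable fun α : ℝ => x + t * α by fun_prop)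
      measurableSet_Ioo)]
    by_cases h : (1:ℝ) ∈ (fun α => x + t * α) ⁻¹' Set.Ioo (-N) N
    · simp only [Set.indicator_of_mem h, Pi.one_apply, ENNReal.toReal_one]
      rw [le_div_iff₀ ht0, one_mul, abs_le]
      simp only [Set.mem_preimage, mul_one, Set.mem_Ioo] at h
      constructor <;> linarith [hx'.1, hx'.2, h.1, h.2]
    · simp only [Set.indicator_of_notMem h, ENNReal.toReal_zero]
      positivity
  · simp only [mu, hl, if_false]
    have hsub : (fun α => x + t * α) ⁻¹' Set.Ioo (-N) N ⊆ Metric.ball (-x / t) (N / |t|) := by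
      intro α hα
      simp only [Set.mem_preimage, ← abs_lt, Set.mem_Ioo] at hα
      rw [Metric.mem_ball, Real.dist_eq, lt_div_iff₀ ht0, ← abs_mul]
      have : (α - -x / t) * t = x + t * α := by field_simp; ring
      rw [this]; exact hα
    have h1 : (volume.restrict (Set.Icc (0:ℝ) 1)).real ((fun α => x + t * α) ⁻¹' Set.Ioo (-N) N) ≤
        volume.real (Metric.ball (-x / t) (N / |t|)) := by
      refine ENNReal.toReal_mono measure_ball_lt_top.ne ?_
      exact (Measure.restrict_apply_le _ _).trans (measure_mono hsub)
    refine h1.trans (le_of_eq ?_)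
    rw [Measure.real, Real.volume_ball, ENNReal.toReal_ofReal (by positivity)]
    ring

lemma ph_decay {d : ℕ} {N : ℝ} (hN : 1 ≤ N) (i j : Fin (d + 2)) (hj : j ≠ i) (t : ℝ) :
    ph N i j t * |t| ≤ 2 * N * VV N i j := by
  rcases eq_or_ne t 0 with rfl | ht
  · simp [VV, hj]; positivity
  have ht0 : 0 < |t| := abs_pos.2 ht
  have := ph_le_c (N := N) (by linarith) i j t (2 * N / |t|) fun x _ => by
    rw [le_div_iff₀ ht0]; exact kk_decay hN i j hj x t
  rw [← le_div_iff₀ ht0]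
  refine this.trans (le_of_eq ?_)
  ring

lemma ph_neg {d : ℕ} {N : ℝ} (hN : 1 ≤ N) (i : Fin (d + 2)) (t : ℝ) (ht : 1 ≤ t) :
    ph N i i (-t) * t ≤ 1 * VV N i i := by
  have ht0 : 0 < t := by linarith
  have := ph_le_c (N := N) (by linarith) i i (-t) (1 / t) fun x hx => by
    have hx' : x ∈ Set.Ioo 0 1 := by simpa [II] using hx
    simp only [kk, hx, Set.indicator_of_mem, SS, if_true]
    by_cases hl : i = Fin.last (d + 1)
    · simp only [mu, hl, if_true, Measure.real]
      rw [Measure.dirac_apply' _ ((show Measurable fun α : ℝ => x + -t * α by fun_prop)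
        measurableSet_Ioi)]
      rw [Set.indicator_of_notMem]
      · simp [ht0.le]
      · simp only [Set.mem_preimage, Set.mem_Ioi, not_lt]; linarith [hx'.2]
    · simp only [mu, hl, if_false]
      have h1 : (volume.restrict (Set.Icc (0:ℝ) 1)).real ((fun α => x + -t * α) ⁻¹' Set.Ioi 0) ≤
          volume.real (Set.Icc 0 (1 / t)) := by
        refine ENNReal.toReal_mono (by simp) ?_
        rw [Measure.restrict_apply' measurableSet_Icc]
        refine measure_mono ?_
        rintro α ⟨h1, h2⟩
        refine ⟨h2.1, ?_⟩
        simp only [Set.mem_preimage, Set.mem_Ioi] at h1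
        rw [le_div_iff₀ ht0]
        linarith [hx'.2]
      refine h1.trans (le_of_eq ?_)
      simp [Measure.real, ht0.le]
  rw [← le_div_iff₀ ht0]
  refine this.trans (le_of_eq ?_)
  ring

lemma prod_aux {ι : Type*} [Fintype ι] [DecidableEq ι] (f V : ι → ℝ) (h0 : ∀ j, 0 ≤ f j)
    (h1 : ∀ j, f j ≤ V j) (i : ι) (s c : ℝ) (hc : 0 ≤ c) (hs : f i * s ≤ c * V i) :
    (∏ j, f j) * s ≤ c * ∏ j, V j := by
  rw [← Finset.mul_prod_erase _ f (Finset.mem_univ i), ← Finset.mul_prod_erase _ V (Finset.mem_univ i)]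
  have a : ∏ j ∈ Finset.univ.erase i, f j ≤ ∏ j ∈ Finset.univ.erase i, V j :=
    Finset.prod_le_prod (fun j _ => h0 j) (fun j _ => h1 j)
  have b : 0 ≤ ∏ j ∈ Finset.univ.erase i, f j := Finset.prod_nonneg fun j _ => h0 j
  have hV := (h0 i).trans (h1 i)

  calc _ = (f i * s) * ∏ j ∈ Finset.univ.erase i, f j := by ring
      _ ≤ (c * V i) * ∏ j ∈ Finset.univ.erase i, f j := by gcongr
      _ ≤ (c * V i) * ∏ j ∈ Finset.univ.erase i, V j := by gcongr
      _ = _ := by ring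

lemma VV_prod {d : ℕ} (N : ℝ) (i : Fin (d + 2)) : ∏ j, VV N i j = N ^ (d + 1) := by
  unfold VV
  rw [← Finset.mul_prod_erase _ _ (Finset.mem_univ i)]
  rw [Finset.prod_congr rfl (g := fun _ => N)]
  · simp
  · intro j hj; simp [Finset.ne_of_mem_erase hj]

lemma ph_meas {d : ℕ} (N : ℝ) (i j : Fin (d + 2)) : Measurable (ph N i j) := by
  have := ((kk_meas N i j).stronglyMeasurable).integral_prod_left' (μ := volume)
  exact this.measurable

lemma kk_eq {d : ℕ} (N : ℝ) (i j : Fin (d + 2)) (x t : ℝ) (hx : x ∈ II N i j) :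
    kk (mu j) (II N i j) (SS N i j) x t
      = ∫ α, (SS N i j).indicator (fun _ => (1:ℝ)) (x + t * α) ∂(mu j) := by
  have hm : MeasurableSet ((fun α => x + t * α) ⁻¹' (SS N i j)) :=
    (show Measurable fun α : ℝ => x + t * α by fun_prop) (SS_meas N i j)
  rw [kk, Set.indicator_of_mem hx, ← integral_indicator_one hm]
  rfl

lemma inner_eq {d : ℕ} (N : ℝ) (i : Fin (d + 2)) (F : ℕ → (Fin (d + 2) → ℝ) → ℝ)
    (hA : ∀ x, F 0 x = ∏ j, (II N i j).indicator (fun _ => (1:ℝ)) (x j))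
    (hB : ∀ x : Fin (d + 2) → ℝ, (∀ j, x j ∈ II N i j) → ∀ (j : Fin (d + 2)) (s : ℝ),
      F (j.1 + 1) (x + Pi.single j s) = (SS N i j).indicator (fun _ => (1:ℝ)) (x j + s))
    (x : Fin (d + 2) → ℝ) (t : ℝ) :
    (∫ α in (Set.univ.pi fun _ : Fin (d + 1) => Set.Icc (0:ℝ) 1),
        F 0 x *
          (∏ j : Fin (d + 1), F (j.1 + 1) (x + Pi.single j.castSucc (t * α j))) *
          F (d + 2) (x + Pi.single (Fin.last (d + 1)) t))
      = ∏ j, kk (mu j) (II N i j) (SS N i j) (x j) t := by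
  by_cases hx : ∀ j, x j ∈ II N i j
  · have h0 : F 0 x = 1 := by
      rw [hA]; exact Finset.prod_eq_one fun j _ => Set.indicator_of_mem (hx j) _
    have h1 : ∀ (j : Fin (d + 1)) (s : ℝ), F (j.1 + 1) (x + Pi.single j.castSucc s) =
        (SS N i j.castSucc).indicator (fun _ => (1:ℝ)) (x j.castSucc + s) := fun j s =>
      hB x hx j.castSucc s
    have h2 := hB x hx (Fin.last (d + 1)) t
    simp only [Fin.val_last] at h2
    simp only [h0, h1, one_mul]
    rw [h2, integral_mul_const, volume_pi, Measure.restrict_pi_pi,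
      integral_fintype_prod_eq_prod (f := fun (j : Fin (d + 1)) (a : ℝ) =>
        (SS N i j.castSucc).indicator (fun _ => (1:ℝ)) (x j.castSucc + t * a)),
      Fin.prod_univ_castSucc (n := d + 1)]
    congr 1
    · refine Finset.prod_congr rfl fun j _ => ?_
      rw [kk_eq N i _ _ _ (hx _)]
      simp [mu, Fin.castSucc_ne_last]
    · rw [kk_eq N i _ _ _ (hx _)]
      simp [mu]
  · push Not at hx
    obtain ⟨j, hj⟩ := hx
    have h0 : F 0 x = 0 := by
      rw [hA]; exact Finset.prod_eq_zero (Finset.mem_univ j) (Set.indicator_of_notMem hj _)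
    rw [Finset.prod_eq_zero (Finset.mem_univ j)]
    · simp [h0]
    · simp [kk, hj]

lemma inv_sq_abs {ε : ℝ} (hε : 0 < ε) :
    IntegrableOn (fun t : ℝ => 1 / t ^ 2) {t : ℝ | ε < |t|} := by
  have hset : {t : ℝ | ε < |t|} = Set.Iio (-ε) ∪ Set.Ioi ε := by
    ext t; simp only [Set.mem_ofPred_eq, lt_abs, Set.mem_union, Set.mem_Iio, Set.mem_Ioi]; constructor
    · rintro (h | h); exacts [Or.inr h, Or.inl (by linarith)]
    · rintro (h | h); exacts [Or.inr (by linarith), Or.inl h]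
  rw [hset]
  refine IntegrableOn.union ?_ (inv_sq_int hε)
  have h := IntegrableOn.comp_neg_Iio (c := -ε) (f := fun t : ℝ => 1 / t ^ 2)
        (by rw [neg_neg]; exact inv_sq_int hε)
  simpa using h

lemma trunc_eq {d : ℕ} {N : ℝ} (hN : 1 ≤ N) (i : Fin (d + 2)) (F : ℕ → (Fin (d + 2) → ℝ) → ℝ)
    (hA : ∀ x, F 0 x = ∏ j, (II N i j).indicator (fun _ => (1:ℝ)) (x j))
    (hB : ∀ x : Fin (d + 2) → ℝ, (∀ j, x j ∈ II N i j) → ∀ (j : Fin (d + 2)) (s : ℝ),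
      F (j.1 + 1) (x + Pi.single j s) = (SS N i j).indicator (fun _ => (1:ℝ)) (x j + s))
    (ε : ℝ) (hε : 0 < ε) :
    simplexTruncR d F ε = ∫ t in {t : ℝ | ε < |t|}, (∏ j, ph N i j t) / t := by
  unfold simplexTruncR
  simp only [inner_eq N i F hA hB]
  rw [integral_integral_swap]
  · refine integral_congr_ae (Filter.Eventually.of_forall fun t => ?_)
    simp only []
    rw [integral_div]
    congr 1
    exact integral_fintype_prod_volume_eq_prod
      (fun (j : Fin (d + 2)) (a : ℝ) => kk (mu j) (II N i j) (SS N i j) a t)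
  · obtain ⟨j1, hj1⟩ := exists_ne i
    have hg : Integrable (fun x : Fin (d + 2) → ℝ =>
        ∏ j, (II N i j).indicator (fun _ => (1:ℝ)) (x j)) := by
      refine Integrable.fintype_prod
        (f := fun j a => (II N i j).indicator (fun _ => (1:ℝ)) a) fun j => ?_
      rw [integrable_indicator_iff (II_meas N i j)]
      exact integrableOn_const (II_fin N i j)
    have hG := hg.mul_prod ((inv_sq_abs hε).const_mul (2 * N))
    refine hG.mono' ?_ ?_
    · refine Measurable.aestronglyMeasurable ?_
      refine Measurable.div ?_ measurable_snd
      refine Finset.measurable_prod _ fun j _ => ?_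
      exact (kk_meas N i j).comp (by fun_prop :
        Measurable fun p : (Fin (d + 2) → ℝ) × ℝ => (p.1 j, p.2))
    · refine Filter.Eventually.of_forall fun p => ?_
      obtain ⟨x, t⟩ := p
      simp only [Function.uncurry]
      have hnn : 0 ≤ ∏ j, kk (mu j) (II N i j) (SS N i j) (x j) t :=
        Finset.prod_nonneg fun j _ => kk_nonneg _ _ _ _ _
      rw [norm_div, Real.norm_of_nonneg hnn, Real.norm_eq_abs]
      rcases eq_or_ne t 0 with rfl | ht
      · simp
      have ht0 : 0 < |t| := abs_pos.2 ht
      have key : (∏ j, kk (mu j) (II N i j) (SS N i j) (x j) t) * |t| ≤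
          2 * N * ∏ j, (II N i j).indicator (fun _ => (1:ℝ)) (x j) := by
        refine prod_aux _ _ (fun j => kk_nonneg _ _ _ _ _) (fun j => kk_le _ _ _ _ _) j1 _ _
          (by linarith) ?_
        by_cases h : x j1 ∈ II N i j1
        · simpa [h] using kk_decay hN i j1 hj1 (x j1) t
        · simp [kk, h]
      rw [div_le_iff₀ ht0, ← sq_abs t]
      rw [← le_div_iff₀ ht0] at key
      refine key.trans (le_of_eq ?_)
      field_simp

lemma lemB {d : ℕ} {N : ℝ} (hN : 2 ≤ N) (i : Fin (d + 2)) (F : ℕ → (Fin (d + 2) → ℝ) → ℝ)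
    (hA : ∀ x, F 0 x = ∏ j, (II N i j).indicator (fun _ => (1:ℝ)) (x j))
    (hB : ∀ x : Fin (d + 2) → ℝ, (∀ j, x j ∈ II N i j) → ∀ (j : Fin (d + 2)) (s : ℝ),
      F (j.1 + 1) (x + Pi.single j s) = (SS N i j).indicator (fun _ => (1:ℝ)) (x j + s)) :
    ∃ L : ℝ, HasSimplexFormR d F L ∧
      N ^ (d + 1) * ((1 / 2) ^ (d + 2) * Real.log (N / 2) - ((d:ℝ) + 2) - 1) ≤ L ∧
      L ≤ N ^ (d + 1) * (((d:ℝ) + 2) + Real.log N + 2) := by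
  have hN1 : 1 ≤ N := by linarith
  have hN0 : 0 ≤ N := by linarith
  have hV : ∀ j, 0 ≤ VV N i j := fun j => by unfold VV; split_ifs <;> linarith
  obtain ⟨j1, hj1⟩ := exists_ne i
  obtain ⟨L, h1, h2, h3⟩ := lemA (fun t => ∏ j, ph N i j t)
    (Finset.measurable_prod _ fun j _ => ph_meas N i j) N (N ^ (d + 1)) ((d:ℝ) + 2)
    ((1 / 2) ^ (d + 2)) hN (by positivity) (by positivity)
    (fun t => Finset.prod_nonneg fun j _ => ph_nonneg N i j t)
    (fun t => by
      rw [← VV_prod N i]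
      exact Finset.prod_le_prod (fun j _ => ph_nonneg N i j t) fun j _ => ph_le hN0 i j t)
    (fun t ht => by
      have a : ∏ j, (VV N i j * (1 - |t|)) ≤ ∏ j, ph N i j t :=
        Finset.prod_le_prod (fun j _ => mul_nonneg (hV j) (by linarith))
          fun j _ => ph_lip hN1 i j t ht
      rw [Finset.prod_mul_distrib, VV_prod, Finset.prod_const, Finset.card_univ,
        Fintype.card_fin] at a
      refine le_trans ?_ a
      gcongr
      have := one_add_mul_le_pow (a := -|t|) (by linarith) (d + 2)
      push_cast at this
      rw [← sub_eq_add_neg] at this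
      linarith)
    (fun t => by
      rw [← VV_prod N i]
      exact prod_aux _ _ (fun j => ph_nonneg N i j t) (fun j => ph_le hN0 i j t) j1 _ _
        (by linarith) (ph_decay hN1 i j1 hj1 t))
    (fun t ht => by
      rw [← VV_prod N i, ← one_mul (∏ j, VV N i j)]
      exact prod_aux _ _ (fun j => ph_nonneg N i j (-t)) (fun j => ph_le hN0 i j (-t)) i _ _
        zero_le_one (ph_neg hN1 i t ht))
    (fun t ht ht' => by
      have a : ∏ j, (VV N i j * (1 / 2)) ≤ ∏ j, ph N i j t :=
        Finset.prod_le_prod (fun j _ => mul_nonneg (hV j) (by norm_num))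
          fun j _ => ph_half hN1 i j t ht ht'
      rw [Finset.prod_mul_distrib, VV_prod, Finset.prod_const, Finset.card_univ,
        Fintype.card_fin] at a
      rw [mul_comm]; exact a)
  refine ⟨L, ?_, h2, h3⟩
  refine h1.congr' ?_
  filter_upwards [self_mem_nhdsWithin] with ε hε
  exact (trunc_eq hN1 i F hA hB ε hε).symm

/-- **Lemma (size of the endpoint counterexample).** Let `n = d + 2 ≥ 2` and
`j₀ ∈ {1,…,n}`. With `F₀(x) = 1_{(0,1)}(x_{j₀}) ∏_{j ≠ j₀} 1_{(0,N)}(x_j)`,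
`F_{j₀}(x) = 1_{(0,∞)}(x_{j₀})`, and
`F_j(x) = 1_{(0,1)}(x_{j₀}) ∏_{ℓ ≠ j₀} 1_{(-N,N)}(x_ℓ)` for `j ∈ {1,…,n} ∖ {j₀}`,
there are constants `c₁, c₂ ∈ (0,∞)` depending only on `n` such that for all sufficiently
large `N` one has `c₁ N^{n-1} log N ≤ Λ^{(n)}(F₀,…,F_n) ≤ c₂ N^{n-1} log N`
(in particular the principal value defining `Λ^{(n)}(F₀,…,F_n)` exists). -/
theorem endpoint_counterexample_size (d : ℕ) :
    ∃ c₁ c₂ : ℝ, 0 < c₁ ∧ 0 < c₂ ∧ ∃ N₀ : ℝ,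
      ∀ j₀ : ℕ, 1 ≤ j₀ → ∀ hj₀' : j₀ ≤ d + 2,
      ∀ N : ℝ, N₀ ≤ N →
      ∀ F : ℕ → (Fin (d + 2) → ℝ) → ℝ,
        (F 0 = fun x =>
          (if 0 < x ⟨j₀ - 1, by omega⟩ ∧ x ⟨j₀ - 1, by omega⟩ < 1 then (1:ℝ) else 0) *
            ∏ j : Fin (d + 2), (if (j : ℕ) = j₀ - 1 then (1:ℝ)
              else if 0 < x j ∧ x j < N then 1 else 0)) →
        (F j₀ = fun x => if 0 < x ⟨j₀ - 1, by omega⟩ then (1:ℝ) else 0) →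
        (∀ j : ℕ, 1 ≤ j → j ≤ d + 2 → j ≠ j₀ →
          F j = fun x =>
            (if 0 < x ⟨j₀ - 1, by omega⟩ ∧ x ⟨j₀ - 1, by omega⟩ < 1 then (1:ℝ) else 0) *
              ∏ ℓ : Fin (d + 2), (if (ℓ : ℕ) = j₀ - 1 then (1:ℝ)
                else if -N < x ℓ ∧ x ℓ < N then 1 else 0)) →
        ∃ L : ℝ, HasSimplexFormR d F L ∧
          c₁ * N ^ (d + 1) * Real.log N ≤ L ∧ L ≤ c₂ * N ^ (d + 1) * Real.log N := by
  set q : ℝ := (1 / 2) ^ (d + 2) with hq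
  have hq0 : 0 < q := by positivity
  have hd : (0:ℝ) ≤ d := by positivity
  -- threshold
  refine ⟨q / 2, d + 5, by positivity, by positivity,
    Real.exp (2 * (q * Real.log 2 + d + 3) / q + 1), ?_⟩
  intro j₀ hj1 hj2 N hN F h0 hj hF
  have hl2 : 0 < Real.log 2 := Real.log_pos (by norm_num)
  have hX : 1 ≤ 2 * (q * Real.log 2 + d + 3) / q + 1 := by
    have : 0 ≤ 2 * (q * Real.log 2 + d + 3) / q := by positivity
    linarith
  have hN2 : 2 ≤ N := by
    have := Real.add_one_le_exp (2 * (q * Real.log 2 + d + 3) / q + 1)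
    linarith
  have hlog : 2 * (q * Real.log 2 + d + 3) / q + 1 ≤ Real.log N := by
    rw [Real.le_log_iff_exp_le (by linarith)]; exact hN
  set i : Fin (d + 2) := ⟨j₀ - 1, by omega⟩ with hi
  have hval : ∀ j : Fin (d + 2), (j : ℕ) = j₀ - 1 ↔ j = i := fun j => by
    rw [Fin.ext_iff]
  obtain ⟨L, hL, hL1, hL2⟩ := lemB hN2 i F (by
    intro x
    rw [h0]
    simp only [hval]
    rw [← Finset.mul_prod_erase _ _ (Finset.mem_univ i),
      ← Finset.mul_prod_erase _ (fun j => (II N i j).indicator (fun _ => (1:ℝ)) (x j))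
        (Finset.mem_univ i)]
    simp only [if_true, one_mul]
    congr 1
    · simp [II, Set.indicator, Set.mem_Ioo]
    · refine Finset.prod_congr rfl fun j hj => ?_
      simp [II, Finset.ne_of_mem_erase hj, Set.indicator, Set.mem_Ioo]) (by
    intro x hx j s
    by_cases hji : j = i
    · have : (j : ℕ) + 1 = j₀ := by
        have := (hval j).2 hji; omega
      rw [this, hj]
      subst hji
      simp [SS, Set.indicator]
    · have hne : (j : ℕ) + 1 ≠ j₀ := by
        intro h
        exact hji ((hval j).1 (by omega))
      rw [hF _ (by omega) (by omega) hne]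
      simp only [hval]
      have hxi := hx i
      simp only [II, if_true, Set.mem_Ioo] at hxi
      have e1 : (x + Pi.single j s : Fin (d + 2) → ℝ) i = x i := by
        simp [Pi.single_eq_of_ne (Ne.symm hji)]
      rw [e1, if_pos hxi, one_mul, Finset.prod_eq_single j]
      · simp [hji, SS, Set.indicator, Set.mem_Ioo]
      · intro l _ hl
        by_cases hli : l = i
        · simp [hli]
        · have hxl := hx l
          simp only [II, hli, if_false, Set.mem_Ioo] at hxl
          have e2 : (x + Pi.single j s : Fin (d + 2) → ℝ) l = x l := by
            simp [Pi.single_eq_of_ne hl]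
          rw [if_neg hli, e2, if_pos ⟨by linarith [hxl.1], hxl.2⟩]
      · simp)
  have hM : 0 < N ^ (d + 1) := by positivity
  refine ⟨L, hL, le_trans ?_ hL1, hL2.trans ?_⟩
  · rw [Real.log_div (by linarith) (by norm_num), ← hq, mul_comm (q / 2), mul_assoc]
    gcongr
    have : 2 * (q * Real.log 2 + d + 3) / q ≤ Real.log N := by linarith
    rw [div_le_iff₀ hq0] at this
    linarith
  · rw [mul_comm ((d:ℝ) + 5), mul_assoc]
    gcongr
    have : 1 ≤ Real.log N := by linarith
    nlinarith
end
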